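/- Let K be a field of characteristic zero and let d̲ = (d_1,…,d_m) be a multidegree with 0 < d_1 ≤ d_2 ≤ … ≤ d_m. There exist positive integers c(d̲) and q = q(d̲) such that for every r ≥ c(d̲) the following holds. Let Z_0,…,Z_q, Y_{q+1},…,Y_r be variables, and for j = 1,…,m let G_j = Σ_{|I| < d_j} b_{j,I,J} Z^I Y^J be a homogeneous polynomial of degree d_j in which every monomial involves at least one Y-variable (so that the linear space L_0 = {Y_{q+1} = … = Y_r = 0} is contained in V = {G_1 = … = G_m = 0}), whose coefficients b_{j,I,J} lie in some extension field of K and are, all taken together, algebraically independent over K. Let K_1 be the field generated over K by all the b_{j,I,J}, set g_j(z_1,…,z_q,y_{q+1},…,y_r) = G_j(1,z_1,…,z_q,y_{q+1},…,y_r), and assume the ideal (g_1,…,g_m) of K_1[z_1,…,z_q,y_{q+1},…,y_r] is prime. Then the fraction field of K_1[z,y]/(g_1,…,g_m) admits a K_1-algebra embedding into a rational function field K_1(t_1,…,t_N) for some N; that is, the complete intersection V, which is generic over K subject to containing L_0, is unirational over K_1. -/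

import Mathlib

universe u

/-- The conclusion of the Morin–Predonzan theorem in Ciliberto's version, for a base
field `K`, a multidegree `dv : Fin m → ℕ`, and candidate constants `c` and `q`:
for every `r ≥ c` (with `q < r`), whenever `G 1, …, G m` are homogeneous forms of degrees
`dv 1, …, dv m` in the variables `Z_0, …, Z_q, Y_{q+1}, …, Y_r` (the variable of index
`i` is a `Z`-variable if `i ≤ q` and a `Y`-variable if `i > q`), each of whose monomials
involves at least one `Y`-variable (so that the linear space `L₀ = {Y = 0}` is contained
in `V = {G 1 = … = G m = 0}`), whose coefficients (in an extension field `K1` of `K`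
generated by them) are all together algebraically independent over `K` — i.e. `V` is
generic over `K` subject to containing `L₀` —, and such that the ideal generated by the
dehomogenizations `g j = G j (1, z_1, …, z_q, y_{q+1}, …, y_r)` is prime, the fraction
field of `K1[z,y]/(g_1, …, g_m)` (the function field of `V` over `K1`) admits a
`K1`-algebra embedding into a rational function field `K1(t_1, …, t_N)`; that is, `V` is
unirational over `K1 = K(l(L₀), θ(V))`. -/
def MPCProperty (K : Type u) [Field K] (m : ℕ) (dv : Fin m → ℕ) (c q : ℕ) : Prop :=
  ∀ r : ℕ, c ≤ r → q < r →
    ∀ (K1 : Type u) [Field K1] [Algebra K K1]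
      (G : Fin m → MvPolynomial (Fin (r + 1)) K1),
      (∀ j, (G j).IsHomogeneous (dv j)) →
      (∀ j, ∀ μ ∈ (G j).support, ∃ i : Fin (r + 1), q < (i : ℕ) ∧ μ i ≠ 0) →
      AlgebraicIndependent K (fun p : (Σ j : Fin m, {μ : Fin (r + 1) →₀ ℕ //
          (∑ i, μ i) = dv j ∧ ∃ i : Fin (r + 1), q < (i : ℕ) ∧ μ i ≠ 0}) =>
        (G p.1).coeff p.2.1) →
      IntermediateField.adjoin K (⋃ j, Set.range (G j).coeff) = ⊤ →
      (Ideal.span (Set.range fun j => MvPolynomial.aeval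
          (fun i : Fin (r + 1) =>
            Fin.cases (motive := fun _ => MvPolynomial (Fin r) K1) 1 (fun i' => MvPolynomial.X i') i) (G j))).IsPrime →
      ∃ (N : ℕ) (ψ : FractionRing ((MvPolynomial (Fin r) K1) ⧸
          (Ideal.span (Set.range fun j => MvPolynomial.aeval
            (fun i : Fin (r + 1) =>
              Fin.cases (motive := fun _ => MvPolynomial (Fin r) K1) 1 (fun i' => MvPolynomial.X i') i) (G j)))) →ₐ[K1]
            FractionRing (MvPolynomial (Fin N) K1)),
        Function.Injective ψ


set_option linter.all false

namespace MPC
open MvPolynomial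

theorem proj_dim {E : Type*} [Field E] [IsAlgClosed E] {ι : Type*} [Fintype ι]
    {κ : Type*} [Fintype κ] (f : κ → MvPolynomial ι E) (hcard : Fintype.card κ < Fintype.card ι)
    (h0 : ∀ k, eval 0 (f k) = 0) : ∃ w : ι → E, w ≠ 0 ∧ ∀ k, eval w (f k) = 0 := by
  by_contra hcon
  push Not at hcon
  -- a maximal ideal of full height
  obtain ⟨M, hM, hMh⟩ : ∃ M : Ideal (MvPolynomial ι E), M.IsMaximal ∧
      ((Fintype.card κ : ℕ) : ℕ∞) < M.height := by
    by_contra hM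
    push Not at hM
    have hd : ringKrullDim (MvPolynomial ι E) = Fintype.card ι := by
      rw [MvPolynomial.ringKrullDim_of_isNoetherianRing, ringKrullDim_eq_zero_of_field]; simp
    have : ringKrullDim (MvPolynomial ι E) ≤ Fintype.card κ := by
      rw [ringKrullDim_le_iff_isMaximal_height_le]
      intro I hI
      exact_mod_cast hM I hI
    rw [hd] at this
    have h2 : Fintype.card ι ≤ Fintype.card κ := by exact_mod_cast this
    omega
  obtain ⟨x, rfl⟩ := (isMaximal_iff_eq_vanishingIdeal_singleton).1 hM
  let g : κ → MvPolynomial ι E := fun k => aeval (fun i => X i - C (x i)) (f k)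
  have hg : ∀ k (y : ι → E), eval y (g k) = eval (y - x) (f k) := by
    intro k y
    simp only [g]
    rw [← coe_aeval_eq_eval, ← coe_aeval_eq_eval]
    simp only [RingHom.coe_coe]
    rw [← AlgHom.comp_apply, comp_aeval]
    congr 2
    funext i
    simp
  have hz : zeroLocus E (Ideal.span (Set.range g)) = {x} := by
    ext y
    simp only [mem_zeroLocus_iff, Set.mem_singleton_iff]
    constructor
    · intro h
      by_contra hy
      obtain ⟨k, hk⟩ := hcon (y - x) (sub_ne_zero.2 hy)
      apply hk
      rw [← hg]
      exact h _ (Ideal.subset_span ⟨k, rfl⟩)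
    · rintro rfl p hp
      have : Ideal.span (Set.range g) ≤ RingHom.ker (aeval (R := E) y : MvPolynomial ι E →ₐ[E] E) := by
        rw [Ideal.span_le]
        rintro _ ⟨k, rfl⟩
        have := hg k y
        rw [sub_self, h0] at this
        exact this
      exact this hp
  have hr : vanishingIdeal E {x} = (Ideal.span (Set.range g)).radical := by
    rw [← hz, vanishingIdeal_zeroLocus_eq_radical]
  have hmin : vanishingIdeal E {x} ∈ (Ideal.span (Set.range g)).minimalPrimes := by
    refine ⟨⟨hM.isPrime, hr ▸ Ideal.le_radical⟩, ?_⟩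
    rintro p ⟨hp, hp'⟩ _
    rw [hr]
    exact hp.radical_le_iff.2 hp'
  have := Ideal.height_le_card_of_mem_minimalPrimes_span (Set.finite_range g) hmin
  have h3 : (Set.range g).ncard ≤ Fintype.card κ := by
    rw [← Set.image_univ]
    exact (Set.ncard_image_le).trans (by simp [Set.ncard_univ])
  have h4 : ((Set.range g).ncard : ℕ∞) ≤ Fintype.card κ := by exact_mod_cast h3
  exact absurd (hMh.trans_le (this.trans h4)) (lt_irrefl _)

theorem totalDegree_aeval_le {R S σ τ : Type*} [CommRing R] [CommRing S] [Algebra R S]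
    (φ : σ → MvPolynomial τ S) (hφ : ∀ i, (φ i).totalDegree ≤ 1) (f : MvPolynomial σ R) :
    (aeval φ f).totalDegree ≤ f.totalDegree := by
  rw [aeval_def, eval₂_eq]
  refine totalDegree_finsetSum_le fun μ hμ => ?_
  refine (totalDegree_mul _ _).trans ?_
  have h1 : (algebraMap R (MvPolynomial τ S) (coeff μ f)).totalDegree = 0 := by
    rw [MvPolynomial.algebraMap_apply]
    exact totalDegree_C _
  rw [h1, zero_add]
  refine (totalDegree_finsetProd _ _).trans ?_
  refine le_trans ?_ (le_totalDegree hμ)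
  rw [Finsupp.sum]
  refine Finset.sum_le_sum fun i _ => ?_
  refine (totalDegree_pow _ _).trans ?_
  nlinarith [hφ i]

/-- One vector more. -/
theorem lin_step {E : Type*} [Field E] [IsAlgClosed E] {ι : Type*} [Fintype ι] [DecidableEq ι]
    (D m n : ℕ) (Zs : Finset ι) (hZ : m * (D + 1) ^ n + n < Zs.card)
    (f : Fin m → MvPolynomial ι E) (hdeg : ∀ j, (f j).totalDegree ≤ D)
    (hcone : ∀ j (z : ι → E) (s : E), s ≠ 0 → eval z (f j) = 0 → eval (s • z) (f j) = 0)
    (v : Fin n → ι → E) (hv : LinearIndependent E v)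
    (hv0 : ∀ (c : Fin n → E) j, eval (∑ i, c i • v i) (f j) = 0) :
    ∃ w : ι → E, (∀ i ∉ Zs, w i = 0) ∧ w ∉ Submodule.span E (Set.range v) ∧
      ∀ (c : Fin n → E) (s : E) j, eval (∑ i, c i • v i + s • w) (f j) = 0 := by
  classical
  -- left inverse
  obtain ⟨l, hl⟩ := (Fintype.linearCombination E v).exists_leftInverse_of_injective
    (LinearMap.ker_eq_bot.2 (linearIndependent_iff_injective_fintypeLinearCombination.1 hv))
  let F : Fin m → MvPolynomial (Fin n) (MvPolynomial ι E) := fun j =>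
    aeval (fun s => ∑ i, C (C (v i s)) * X i + C (X s)) (f j)
  have hFdeg : ∀ j, (F j).totalDegree ≤ D := fun j => by
    refine (totalDegree_aeval_le _ ?_ (f j)).trans (hdeg j)
    intro s
    refine (totalDegree_add _ _).trans (max_le ?_ (by simp))
    refine totalDegree_finsetSum_le fun i _ => (totalDegree_mul _ _).trans ?_
    simp
  have hFev : ∀ j (c : Fin n → E) (w : ι → E),
      eval c (map (eval w) (F j)) = eval (∑ i, c i • v i + w) (f j) := by
    intro j c w
    have : ((eval c).comp (map (eval w))).comp
        (aeval (fun s => ∑ i, C (C (v i s)) * X i + C (X s)) :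
          MvPolynomial ι E →ₐ[E] MvPolynomial (Fin n) (MvPolynomial ι E)).toRingHom =
        eval (∑ i, c i • v i + w) := by
      apply MvPolynomial.ringHom_ext
      · intro a
        simp [MvPolynomial.algebraMap_eq]
      · intro s
        simp [Finset.sum_apply, mul_comm]
    exact congrArg (fun g : MvPolynomial ι E →+* E => g (f j)) this
  let κ := ((Fin m × (Fin n → Fin (D + 1))) ⊕ Fin n) ⊕ {i : ι // i ∉ Zs}
  let lp : Fin n → MvPolynomial ι E := fun k => ∑ i, C (l (Pi.single i 1) k) * X i
  have hlp : ∀ k w, eval w (lp k) = l w k := by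
    intro k w
    have hw : w = ∑ i, w i • (Pi.single i (1 : E) : ι → E) := by
      ext i; simp [Finset.sum_apply, Pi.single_apply]
    conv_rhs => rw [hw]
    simp [lp, mul_comm]
  let e : κ → MvPolynomial ι E := Sum.elim (Sum.elim
    (fun p => coeff (Finsupp.equivFunOnFinite.symm (fun i => (p.2 i : ℕ))) (F p.1)) lp) (fun i => X i.1)
  have hcard : Fintype.card κ < Fintype.card ι := by
    have h1 : Fintype.card {i : ι // i ∉ Zs} = Fintype.card ι - Zs.card := by
      rw [Fintype.card_subtype_compl]; simp
    have h2 : Zs.card ≤ Fintype.card ι := Finset.card_le_univ _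
    simp only [κ, Fintype.card_sum, Fintype.card_prod, Fintype.card_fun, Fintype.card_fin, h1]
    omega
  obtain ⟨w, hw0, hw⟩ := proj_dim e hcard (by
    rintro ((p | k) | i)
    · have : map (eval (0 : ι → E)) (F p.1) = 0 := by
        apply MvPolynomial.funext
        intro c
        rw [hFev, add_zero, hv0, map_zero]
      simp only [e, Sum.elim_inl]
      rw [← coeff_map, this, coeff_zero]
    · simp only [e, Sum.elim_inl, Sum.elim_inr, hlp, map_zero, Pi.zero_apply]
    · simp [e])
  have hFw : ∀ j, map (eval w) (F j) = 0 := by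
    intro j
    ext α
    rw [coeff_zero, coeff_map]
    by_cases hα : D < α.degree
    · rw [coeff_eq_zero_of_totalDegree_lt, map_zero]
      exact (hFdeg j).trans_lt hα
    · have hα' : ∀ i, α i < D + 1 := fun i => by
        have := Finsupp.le_degree i α
        omega
      have := hw (Sum.inl (Sum.inl (j, fun i => ⟨α i, hα' i⟩)))
      simp only [e, Sum.elim_inl] at this
      convert this
      ext i; rfl
  refine ⟨w, fun i hi => by simpa [e] using hw (Sum.inr ⟨i, hi⟩), ?_, ?_⟩
  · intro hmem
    obtain ⟨c, rfl⟩ := (Submodule.mem_span_range_iff_exists_fun E).1 hmem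
    have hlw : l (∑ i, c i • v i) = 0 := by
      ext k
      rw [← hlp]
      exact hw (Sum.inl (Sum.inr k))
    have := LinearMap.congr_fun hl c
    simp only [LinearMap.comp_apply, Fintype.linearCombination_apply, LinearMap.id_apply] at this
    rw [this] at hlw
    apply hw0
    simp [hlw]
  · intro c s j
    by_cases hs : s = 0
    · simp [hs, hv0]
    · have := hcone j (∑ i, (s⁻¹ * c i) • v i + w) s hs (by
        rw [← hFev, hFw, map_zero])
      rw [smul_add, Finset.smul_sum] at this
      simpa [smul_smul, hs] using this

theorem lin {E : Type*} [Field E] [IsAlgClosed E] {ι : Type*} [Fintype ι] [DecidableEq ι]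
    (D m : ℕ) (Zs : Finset ι)
    (f : Fin m → MvPolynomial ι E) (hdeg : ∀ j, (f j).totalDegree ≤ D)
    (hcone : ∀ j (z : ι → E) (s : E), s ≠ 0 → eval z (f j) = 0 → eval (s • z) (f j) = 0)
    (h0 : ∀ j, eval 0 (f j) = 0) (n : ℕ) (hZ : m * (D + 1) ^ n + n < Zs.card) :
    ∃ v : Fin n → ι → E, LinearIndependent E v ∧ (∀ k, ∀ i ∉ Zs, v k i = 0) ∧
      ∀ (c : Fin n → E) j, eval (∑ i, c i • v i) (f j) = 0 := by
  induction n with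
  | zero => exact ⟨Fin.elim0, linearIndependent_empty_type, fun k => k.elim0, fun c j => by
      rw [Finset.univ_eq_empty, Finset.sum_empty]; exact h0 j⟩
  | succ n ih =>
    have hpow : m * (D + 1) ^ n ≤ m * (D + 1) ^ (n + 1) :=
      Nat.mul_le_mul_left _ (Nat.pow_le_pow_right (by omega) (by omega))
    obtain ⟨v, hv, hvZ, hv0⟩ := ih (by omega)
    obtain ⟨w, hwZ, hw, hw0⟩ := lin_step D m n Zs (by omega) f hdeg hcone v hv hv0
    refine ⟨Fin.snoc v w, ?_, ?_, ?_⟩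
    · exact linearIndependent_finSnoc.2 ⟨hv, hw⟩
    · intro k
      refine Fin.lastCases ?_ (fun k => ?_) k
      · simpa using hwZ
      · simpa using hvZ k
    · intro c j
      rw [Fin.sum_univ_castSucc]
      simpa using hw0 (fun i => c i.castSucc) (c (Fin.last n)) j

end MPC

namespace MPC
open MvPolynomial

section Sub
variable {ι : Type*} [Fintype ι] [DecidableEq ι] {R S : Type*} [CommRing R] [CommRing S]

/-- Linear substitution. -/
noncomputable def Sub (h : Matrix ι ι R) : MvPolynomial ι R →ₐ[R] MvPolynomial ι R :=
  aeval (fun i => ∑ j, C (h i j) * X j)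

theorem Sub_X (h : Matrix ι ι R) (i : ι) : Sub h (X i) = ∑ j, C (h i j) * X j := by
  simp [Sub]

theorem Sub_Sub (h h' : Matrix ι ι R) (G : MvPolynomial ι R) :
    Sub h' (Sub h G) = Sub (h * h') G := by
  rw [← AlgHom.comp_apply]
  congr 1
  apply MvPolynomial.algHom_ext
  intro i
  simp only [AlgHom.comp_apply, Sub_X, map_sum, map_mul, Matrix.mul_apply]
  simp only [Finset.sum_mul, Finset.mul_sum]
  rw [Finset.sum_comm]
  refine Finset.sum_congr rfl fun j _ => ?_
  have : Sub h' (C (h i j)) = C (h i j) := by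
    simp [Sub]
  simp only [map_mul, Sub_X, map_sum, mul_assoc, this, algHom_C, algebraMap_eq, Finset.mul_sum] 

theorem Sub_one (G : MvPolynomial ι R) : Sub (1 : Matrix ι ι R) G = G := by
  have : Sub (1 : Matrix ι ι R) = AlgHom.id R _ := by
    apply MvPolynomial.algHom_ext
    intro i
    simp [Sub_X, Matrix.one_apply]
  rw [this]; rfl

theorem eval_Sub (h : Matrix ι ι R) (x : ι → R) (G : MvPolynomial ι R) :
    eval x (Sub h G) = eval (h.mulVec x) G := by
  have : (eval x).comp (Sub h).toRingHom = eval (h.mulVec x) := by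
    apply MvPolynomial.ringHom_ext
    · intro r; simp [Sub]
    · intro i; simp [Sub, Matrix.mulVec, dotProduct]
  exact congrArg (fun g : MvPolynomial ι R →+* R => g G) this

theorem map_Sub (f : R →+* S) (h : Matrix ι ι R) (G : MvPolynomial ι R) :
    map f (Sub h G) = Sub (h.map f) (map f G) := by
  have : (map f).comp (Sub h).toRingHom = (Sub (h.map f)).toRingHom.comp (map f) := by
    apply MvPolynomial.ringHom_ext
    · intro r; simp [Sub]
    · intro i; simp [Sub]
  exact congrArg (fun g : MvPolynomial ι R →+* MvPolynomial ι S => g G) this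

theorem Sub_homog (h : Matrix ι ι R) {G : MvPolynomial ι R} {d : ℕ} (hG : G.IsHomogeneous d) :
    (Sub h G).IsHomogeneous d := by
  have := hG.aeval (fun i => ∑ j, C (h i j) * X j) (n := 1) (fun i => by
    apply IsHomogeneous.sum
    intro j _
    simpa using (isHomogeneous_C ι (h i j)).mul (isHomogeneous_X R j))
  simpa [Sub] using this

theorem coeff_Sub_mem {K Ω : Type*} [Field K] [Field Ω] [Algebra K Ω] (F : IntermediateField K Ω)
    (h : Matrix ι ι Ω) (hh : ∀ i j, h i j ∈ F) (G : MvPolynomial ι Ω) (hG : ∀ μ, coeff μ G ∈ F)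
    (μ : ι →₀ ℕ) : coeff μ (Sub h G) ∈ F := by
  have hG' : G ∈ Set.range (map (algebraMap F Ω)) := by
    rw [mem_range_map_iff_coeffs_subset]
    intro x hx
    obtain ⟨ν, _, rfl⟩ := mem_coeffs_iff.1 hx
    exact ⟨⟨_, hG ν⟩, rfl⟩
  obtain ⟨G', rfl⟩ := hG'
  have : h = (Matrix.of fun i j => (⟨h i j, hh i j⟩ : F)).map (algebraMap F Ω) := by
    ext i j; rfl
  rw [this]
  change coeff μ (Sub _ (map (algebraMap F Ω) G')) ∈ F
  rw [← map_Sub, coeff_map]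
  exact SetLike.coe_mem _

end Sub

section Good
variable {ι : Type*} [Fintype ι] [DecidableEq ι] {R : Type*} [CommRing R] (P : ι) (lam : ι → ℕ)

def Good (k : ℕ) (μ : ι →₀ ℕ) : Prop := μ P ≤ k → ∃ a, a ≠ P ∧ μ a ≠ 0 ∧ lam a ≤ μ P

def Bad (k : ℕ) (μ : ι →₀ ℕ) : Prop := μ P = k ∧ ∀ a, a ≠ P → μ a ≠ 0 → k < lam a

theorem good_iff (k : ℕ) (μ : ι →₀ ℕ) :
    Good P lam k μ ↔ (Good P lam (k+1) μ ∨ Bad P lam (k+1) μ) := by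
  unfold Good Bad
  constructor
  · intro h
    by_cases h1 : μ P ≤ k
    · exact Or.inl fun _ => h h1
    · by_cases h2 : μ P = k + 1
      · by_cases h3 : ∃ a, a ≠ P ∧ μ a ≠ 0 ∧ lam a ≤ μ P
        · exact Or.inl fun _ => h3
        · push Not at h3
          exact Or.inr ⟨h2, fun a ha hμ => by have := h3 a ha hμ; omega⟩
      · exact Or.inl fun _ => by omega
  · rintro (h | ⟨h, _⟩) h1
    · exact h (by omega)
    · omega

theorem not_good_of_bad (k : ℕ) (μ : ι →₀ ℕ) (h : Bad P lam k μ) : ¬ Good P lam k μ := by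
  intro hg
  obtain ⟨a, ha, hμ, hl⟩ := hg h.1.le
  have := h.2 a ha hμ
  have := h.1
  omega

def InS (k : ℕ) (G : MvPolynomial ι R) : Prop := ∀ μ ∈ G.support, Good P lam k μ

theorem inS_succ {k : ℕ} {G : MvPolynomial ι R} (h : InS P lam k G)
    (hb : ∀ μ, Bad P lam (k+1) μ → coeff μ G = 0) : InS P lam (k+1) G := by
  intro μ hμ
  rcases (good_iff P lam k μ).1 (h μ hμ) with h1 | h1
  · exact h1
  · exact absurd (hb μ h1) (mem_support_iff.1 hμ)

theorem InS.of_le {k k' : ℕ} {G : MvPolynomial ι R} (h : InS P lam k G) (hk : k' ≤ k) : InS P lam k' G :=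
  fun μ hμ h1 => h μ hμ (by omega)

def gens (k : ℕ) : Set (ι →₀ ℕ) :=
  {μ | (∃ a, a ≠ P ∧ lam a ≤ k ∧ μ = Finsupp.single a 1) ∨ μ = Finsupp.single P (k+1)}

noncomputable def J (R : Type*) [CommRing R] (k : ℕ) : Ideal (MvPolynomial ι R) :=
  Ideal.span ((fun s => monomial s (1 : R)) '' gens P lam k)

theorem X_mem_J {k : ℕ} {a : ι} (ha : a ≠ P) (hl : lam a ≤ k) : (X a : MvPolynomial ι R) ∈ J P lam R k :=
  Ideal.subset_span ⟨_, Or.inl ⟨a, ha, hl, rfl⟩, rfl⟩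

theorem XP_mem_J {k : ℕ} : (X P ^ (k+1) : MvPolynomial ι R) ∈ J P lam R k := by
  refine Ideal.subset_span ⟨_, Or.inr rfl, ?_⟩
  simp [X_pow_eq_monomial]

theorem mem_J {k : ℕ} {G : MvPolynomial ι R} : G ∈ J P lam R k ↔
    ∀ μ ∈ G.support, (k < μ P ∨ ∃ a, a ≠ P ∧ μ a ≠ 0 ∧ lam a ≤ k) := by
  unfold J
  rw [mem_ideal_span_monomial_image]
  refine forall₂_congr fun μ _ => ?_
  constructor
  · rintro ⟨s, (⟨a, ha, hl, rfl⟩ | rfl), hs⟩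
    · exact Or.inr ⟨a, ha, by simpa [Nat.one_le_iff_ne_zero] using hs, hl⟩
    · exact Or.inl (by simpa only [Finsupp.single_le_iff, Nat.succ_le_iff] using hs)
  · rintro (h | ⟨a, ha, hμ, hl⟩)
    · exact ⟨_, Or.inr rfl, by simpa only [Finsupp.single_le_iff, Nat.succ_le_iff] using h⟩
    · exact ⟨_, Or.inl ⟨a, ha, hl, rfl⟩, by simpa [Nat.one_le_iff_ne_zero] using hμ⟩

theorem inS_iff {k : ℕ} {G : MvPolynomial ι R} : InS P lam k G ↔ ∀ k' ≤ k, G ∈ J P lam R k' := by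
  constructor
  · intro h k' hk'
    rw [mem_J]
    intro μ hμ
    by_cases h1 : k' < μ P
    · exact Or.inl h1
    · obtain ⟨a, ha, ha', hl⟩ := h μ hμ (by omega)
      exact Or.inr ⟨a, ha, ha', by omega⟩
  · intro h μ hμ h1
    rcases (mem_J P lam).1 (h _ h1) μ hμ with h2 | h2
    · omega
    · exact h2

/-- If monomials in the support map into `J k'`, everything does. -/
theorem hom_mem_J {k k' : ℕ} {G : MvPolynomial ι R} (hG : InS P lam k G)
    (φ : MvPolynomial ι R →ₐ[R] MvPolynomial ι R)
    (h : ∀ μ : ι →₀ ℕ, Good P lam k μ → (∏ i, φ (X i) ^ μ i) ∈ J P lam R k') : φ G ∈ J P lam R k' := by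
  rw [G.as_sum, map_sum]
  refine Ideal.sum_mem _ fun μ hμ => ?_
  rw [monomial_eq, map_mul, Finsupp.prod_fintype _ _ (by simp), map_prod]
  simp only [map_pow]
  exact Ideal.mul_mem_left _ _ (h μ (hG μ hμ))

theorem prod_mem_of_pair {k' : ℕ} (f : ι → MvPolynomial ι R) (μ : ι →₀ ℕ) (a : ι) (ha : a ≠ P) (hμ : μ a ≠ 0)
    (h : f a * f P ^ μ P ∈ J P lam R k') : (∏ i, f i ^ μ i) ∈ J P lam R k' := by
  rw [← Finset.mul_prod_erase _ _ (Finset.mem_univ a),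
    ← Finset.mul_prod_erase _ _ (Finset.mem_erase.2 ⟨ha.symm, Finset.mem_univ P⟩)]
  obtain ⟨n, hn⟩ := Nat.exists_eq_succ_of_ne_zero hμ
  rw [hn, pow_succ]
  rw [show ∀ a b c d : MvPolynomial ι R, a * b * (c * d) = (a * d) * (b * c) by intros; ring]
  exact Ideal.mul_mem_left _ _ h

theorem prod_mem_of_P {k' : ℕ} (f : ι → MvPolynomial ι R) (μ : ι →₀ ℕ) 
    (h : f P ^ μ P ∈ J P lam R k') : (∏ i, f i ^ μ i) ∈ J P lam R k' := by
  rw [← Finset.mul_prod_erase _ _ (Finset.mem_univ P)]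
  exact Ideal.mul_mem_right _ _ h

/-- A substitution fixing all variables with `lam ≤ k` and `P` preserves `InS k`. -/
theorem inS_Sub_of_fix {k : ℕ} {G : MvPolynomial ι R} (hG : InS P lam k G) (h : Matrix ι ι R)
    (hP : Sub h (X P) = X P) (hfix : ∀ a, lam a ≤ k → Sub h (X a) = X a) : InS P lam k (Sub h G) := by
  rw [inS_iff]
  intro k' hk'
  refine hom_mem_J P lam hG _ fun μ hμ => ?_
  by_cases h1 : k' < μ P
  · apply prod_mem_of_P
    rw [hP]
    obtain ⟨n, hn⟩ := Nat.exists_eq_add_of_lt h1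
    rw [hn, show k' + n + 1 = n + (k' + 1) by ring, pow_add]
    exact Ideal.mul_mem_left _ _ (XP_mem_J P lam)
  · obtain ⟨a, ha, ha', hl⟩ := hμ (by omega)
    refine prod_mem_of_pair P lam _ μ a ha ha' ?_
    rw [hfix a (by omega)]
    exact Ideal.mul_mem_right _ _ (X_mem_J P lam ha (by omega))

/-- The shear `X a ↦ X a + p a X P`. -/
def shear (p : ι → R) : Matrix ι ι R := 1 + Matrix.of fun i j => if j = P then p i else 0

theorem Sub_shear_X (p : ι → R) (a : ι) : Sub (shear P p) (X a) = X a + C (p a) * X P := by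
  rw [Sub_X]
  simp only [shear, Matrix.add_apply, Matrix.of_apply, C_add, add_mul, Finset.sum_add_distrib]
  congr 1
  · simp [Matrix.one_apply]
  · simp [apply_ite, ite_mul]

theorem shear_mul (p p' : ι → R) (hp : p' P = 0) : shear P p * shear P p' = shear P (p + p') := by
  have : (Matrix.of fun i j => if j = P then p i else 0) *
      (Matrix.of fun i j => if j = P then p' i else 0) = 0 := by
    ext i j
    simp [Matrix.mul_apply, hp]
  rw [shear, shear, add_mul, mul_add, mul_add, this]
  ext i j
  simp only [shear, one_mul, mul_one, Matrix.add_apply, Matrix.of_apply, Pi.add_apply, Matrix.zero_apply]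
  by_cases hj : j = P
  · simp only [hj, if_true]; ring
  · simp [hj]

theorem shear_zero : shear P (0 : ι → R) = 1 := by
  ext i j; simp [shear]

theorem Sub_shear_neg (p : ι → R) (hp : p P = 0) (G : MvPolynomial ι R) :
    Sub (shear P (-p)) (Sub (shear P p) G) = G := by
  rw [Sub_Sub, shear_mul _ _ _ (by simp [hp]), add_neg_cancel, shear_zero, Sub_one]

theorem inS_Sub_shear {k : ℕ} {G : MvPolynomial ι R} (hG : InS P lam k G) (p : ι → R)
    (hp : ∀ a, p a ≠ 0 → a ≠ P ∧ lam a = k) : InS P lam k (Sub (shear P p) G) := by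
  have hpP : p P = 0 := by
    by_contra h; exact (hp P h).1 rfl
  have hP : Sub (shear P p) (X P) = X P := by rw [Sub_shear_X, hpP]; simp
  have hlt : ∀ a, lam a ≠ k → Sub (shear P p) (X a) = X a := by
    intro a ha
    have : p a = 0 := by
      by_contra h; exact ha (hp a h).2
    rw [Sub_shear_X, this]; simp
  rw [inS_iff]
  intro k' hk'
  refine hom_mem_J P lam hG _ fun μ hμ => ?_
  by_cases h1 : k' < μ P
  · apply prod_mem_of_P
    rw [hP]
    obtain ⟨n, hn⟩ := Nat.exists_eq_add_of_lt h1
    rw [hn, show k' + n + 1 = n + (k' + 1) by ring, pow_add]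
    exact Ideal.mul_mem_left _ _ (XP_mem_J P lam)
  · obtain ⟨a, ha, ha', hl⟩ := hμ (by omega)
    refine prod_mem_of_pair P lam _ μ a ha ha' ?_
    by_cases hak : lam a = k
    · have e1 : μ P = k := by omega
      have e2 : k' = k := by omega
      subst e2
      rw [hP, Sub_shear_X, e1, add_mul]
      refine Ideal.add_mem _ (Ideal.mul_mem_right _ _ (X_mem_J P lam ha (by omega))) ?_
      rw [mul_assoc, ← pow_succ']
      exact Ideal.mul_mem_left _ _ (XP_mem_J P lam)
    · rw [hlt a hak]
      exact Ideal.mul_mem_right _ _ (X_mem_J P lam ha (by omega))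

/-- A substitution preserving the span of the `lam = 0` variables preserves `InS 0`. -/
theorem inS_zero_Sub {G : MvPolynomial ι R} (hG : InS P lam 0 G) (hlP : lam P = 0) (h : Matrix ι ι R)
    (hpat : ∀ i j, lam i = 0 → lam j ≠ 0 → h i j = 0) : InS P lam 0 (Sub h G) := by
  have key : ∀ i, lam i = 0 → Sub h (X i) ∈ J P lam R 0 := by
    intro i hi
    rw [Sub_X]
    refine Ideal.sum_mem _ fun j _ => ?_
    by_cases hj : lam j = 0
    · refine Ideal.mul_mem_left _ _ ?_
      by_cases hjP : j = P
      · subst hjP; simpa using XP_mem_J j lam (k := 0) (R := R)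
      · exact X_mem_J P lam hjP hj.le
    · rw [hpat i j hi hj]; simp
  rw [inS_iff]
  intro k' hk'
  obtain rfl : k' = 0 := by omega
  refine hom_mem_J P lam hG _ fun μ hμ => ?_
  by_cases h1 : μ P = 0
  · obtain ⟨a, ha, ha', hl⟩ := hμ (by omega)
    exact prod_mem_of_pair P lam _ μ a ha ha' (Ideal.mul_mem_right _ _ (key a (by omega)))
  · apply prod_mem_of_P
    exact Ideal.pow_mem_of_mem _ (key P hlP) _ (by omega)

end Good
end MPC

namespace MPC
open MvPolynomial

section Coeff
variable {ι : Type*} [Fintype ι] [DecidableEq ι] {R : Type*} [CommRing R] (P : ι) (lam : ι → ℕ)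

theorem coeff_kill (Kl : ι → Prop) [DecidablePred Kl] (ν : ι →₀ ℕ) (hν : ∀ a, Kl a → ν a = 0)
    (F : MvPolynomial ι R) :
    coeff ν (aeval (fun i => if Kl i then 0 else (X i : MvPolynomial ι R)) F) = coeff ν F := by
  induction F using MvPolynomial.induction_on' with
  | add p q hp hq => rw [map_add, coeff_add, coeff_add, hp, hq]
  | monomial μ c =>
    by_cases h : ∃ a, Kl a ∧ μ a ≠ 0
    · obtain ⟨a, ha, hμ⟩ := h
      have h1 : μ ≠ ν := by rintro rfl; exact hμ (hν a ha)
      rw [coeff_monomial, if_neg h1, aeval_monomial, Finsupp.prod_fintype _ _ (by simp),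
        Finset.prod_eq_zero (Finset.mem_univ a)]
      · simp
      · simp [ha, hμ]
    · push Not at h
      have : aeval (fun i => if Kl i then 0 else (X i : MvPolynomial ι R)) (monomial μ c) = monomial μ c := by
        rw [aeval_monomial, monomial_eq, Finsupp.prod_fintype _ _ (by simp), Finsupp.prod_fintype _ _ (by simp)]
        congr 1
        refine Finset.prod_congr rfl fun i _ => ?_
        by_cases hi : Kl i
        · simp [h i hi]
        · simp [hi]
      rw [this]

theorem aeval_mono (τ : ι → ι) (w : ι → R) (μ : ι →₀ ℕ) (c : R) :
    aeval (fun i => (monomial (Finsupp.single (τ i) 1) (w i) : MvPolynomial ι R)) (monomial μ c) =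
      monomial (μ.mapDomain τ) (c * ∏ i, w i ^ μ i) := by
  rw [aeval_monomial, Finsupp.prod_fintype _ _ (by simp)]
  have : ∀ i, (monomial (Finsupp.single (τ i) 1) (w i) : MvPolynomial ι R) ^ μ i =
      monomial (μ i • Finsupp.single (τ i) 1) (w i ^ μ i) := fun i => by rw [monomial_pow]
  simp only [this]
  have h2 : ∀ s : Finset ι, ∏ i ∈ s, (monomial (μ i • Finsupp.single (τ i) 1) (w i ^ μ i) : MvPolynomial ι R)
      = monomial (∑ i ∈ s, μ i • Finsupp.single (τ i) 1) (∏ i ∈ s, w i ^ μ i) := by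
    intro s
    induction s using Finset.induction_on with
    | empty => simp
    | insert a s ha ih => rw [Finset.prod_insert ha, ih, monomial_mul, Finset.sum_insert ha, Finset.prod_insert ha]
  rw [h2, algebraMap_eq, C_mul_monomial]
  have h3 : ∑ i, μ i • Finsupp.single (τ i) 1 = μ.mapDomain τ := by
    rw [Finsupp.mapDomain, Finsupp.sum_fintype _ _ (by simp)]
    refine Finset.sum_congr rfl fun i _ => ?_
    simp
  rw [h3]

theorem coeff_shear_monomial {k : ℕ} (p : ι → R) (hp : ∀ a, p a ≠ 0 → a ≠ P ∧ lam a = k)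
    (ν : ι →₀ ℕ) (hν : Bad P lam (k+1) ν) (μ : ι →₀ ℕ) (hμ : Good P lam k μ) (c : R) :
    coeff ν (Sub (shear P p) (monomial μ c)) = coeff ν (monomial μ c) +
      ∑ a, p a * coeff (ν - Finsupp.single P 1 + Finsupp.single a 1) (monomial μ c) := by
  classical
  let Kl : ι → Prop := fun a => a ≠ P ∧ lam a ≤ k + 1
  let τ : ι → ι := fun a => if Kl a then P else a
  let w : ι → R := fun a => if Kl a then p a else 1
  have hνKl : ∀ a, Kl a → ν a = 0 := by
    intro a ha
    by_contra h
    have := hν.2 a ha.1 h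
    have := ha.2
    omega
  have hKlP : ¬ Kl P := fun h => h.1 rfl
  have hpKl : ∀ a, p a ≠ 0 → Kl a := fun a h => ⟨(hp a h).1, by have := (hp a h).2; omega⟩
  have hcomp : (aeval (fun i => if Kl i then 0 else (X i : MvPolynomial ι R))).comp (Sub (shear P p)) =
      aeval (fun i => (monomial (Finsupp.single (τ i) 1) (w i) : MvPolynomial ι R)) := by
    apply MvPolynomial.algHom_ext
    intro i
    rw [AlgHom.comp_apply, Sub_shear_X, map_add, map_mul, aeval_X, aeval_X, aeval_X, if_neg hKlP, aeval_C]
    by_cases hi : Kl i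
    · simp only [hi, if_true, τ, w, zero_add, algebraMap_eq]
      rw [C_mul_X_eq_monomial]
    · have : p i = 0 := by
        by_contra h; exact hi (hpKl i h)
      simp [hi, τ, w, this]
      rfl
  have h1 : coeff ν (Sub (shear P p) (monomial μ c)) =
      if μ.mapDomain τ = ν then c * ∏ i, w i ^ μ i else 0 := by
    rw [← coeff_kill Kl ν hνKl, ← AlgHom.comp_apply, hcomp, aeval_mono, coeff_monomial]
  rw [h1]
  simp only [coeff_monomial]
  have hτP : τ P = P := by simp [τ]
  have hmono : ∀ (η : ι →₀ ℕ), (∀ a, Kl a → η a = 0) → η.mapDomain τ = η := by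
    intro η hη
    conv_rhs => rw [← Finsupp.mapDomain_id (v := η)]
    apply Finsupp.mapDomain_congr
    intro x hx
    have : ¬ Kl x := fun h => (Finsupp.mem_support_iff.1 hx) (hη x h)
    simp [τ, this]
  have hνP : Finsupp.single P 1 ≤ ν := by
    rw [Finsupp.single_le_iff, hν.1]; omega
  have hν' : ∀ a, Kl a → (ν - Finsupp.single P 1 : ι →₀ ℕ) a = 0 := by
    intro a ha; simp [hνKl a ha]
  have hν2 : (ν - Finsupp.single P 1 : ι →₀ ℕ) P = k := by simp [hν.1]
  by_cases hA : ∀ a, Kl a → μ a = 0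
  · rw [hmono μ hA]
    rw [Finset.sum_eq_zero, add_zero]
    · have : ∏ i, w i ^ μ i = 1 := by
        refine Finset.prod_eq_one fun i _ => ?_
        by_cases hi : Kl i
        · simp [hA i hi]
        · simp [w, hi]
      rw [this, mul_one]
    · intro a _
      by_cases hpa : p a = 0
      · simp [hpa]
      · rw [if_neg, mul_zero]
        intro h
        have := hA a (hpKl a hpa)
        rw [h] at this
        simp at this
  · push Not at hA
    obtain ⟨a, haK, ha⟩ := hA
    have hne : μ ≠ ν := by rintro rfl; exact ha (hνKl a haK)
    rw [if_neg hne, zero_add]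
    obtain ⟨μ', rfl⟩ : ∃ μ', μ = μ' + Finsupp.single a 1 :=
      ⟨μ - Finsupp.single a 1, (tsub_add_cancel_of_le (by
        rw [Finsupp.single_le_iff]; omega)).symm⟩
    have hmd : (μ' + Finsupp.single a 1).mapDomain τ = μ'.mapDomain τ + Finsupp.single P 1 := by
      rw [Finsupp.mapDomain_add, Finsupp.mapDomain_single]
      simp [τ, haK]
    by_cases hB : ∀ b, Kl b → μ' b = 0
    · rw [hmd, hmono μ' hB]
      have hprod : ∏ i, w i ^ (μ' + Finsupp.single a 1 : ι →₀ ℕ) i = p a := by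
        simp only [Finsupp.add_apply, pow_add, Finset.prod_mul_distrib]
        have e1 : ∏ i, w i ^ μ' i = 1 := by
          refine Finset.prod_eq_one fun i _ => ?_
          by_cases hi : Kl i
          · simp [hB i hi]
          · simp [w, hi]
        rw [e1, one_mul, Finset.prod_eq_single a]
        · simp [w, haK]
        · intro b _ hb; simp [Finsupp.single_apply, hb.symm]
        · simp
      rw [hprod]
      have hiff : ∀ b, p b ≠ 0 → (μ' + Finsupp.single a 1 = ν - Finsupp.single P 1 + Finsupp.single b 1 ↔
          (a = b ∧ μ' + Finsupp.single P 1 = ν)) := by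
        intro b hb
        constructor
        · intro h
          have hab : a = b := by
            by_contra hab
            have := DFunLike.congr_fun h a
            rw [Finsupp.add_apply, Finsupp.add_apply, hν' a haK, Finsupp.single_eq_same,
              Finsupp.single_apply, if_neg (Ne.symm hab)] at this
            omega
          subst hab
          refine ⟨rfl, ?_⟩
          rw [add_right_cancel h, tsub_add_cancel_of_le hνP]
        · rintro ⟨rfl, rfl⟩
          simp
      rw [Finset.sum_eq_single a]
      · by_cases hpa : p a = 0
        · simp [hpa]
        · simp only [hiff a hpa, true_and]
          split_ifs <;> simp [mul_comm]
      · intro b _ hb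
        by_cases hpb : p b = 0
        · simp [hpb]
        · rw [if_neg, mul_zero]
          rw [hiff b hpb]
          rintro ⟨h, _⟩
          exact hb h.symm
      · simp
    · push Not at hB
      obtain ⟨b, hbK, hb⟩ := hB
      rw [Finset.sum_eq_zero]
      · split_ifs with h
        · obtain ⟨μ'', rfl⟩ : ∃ μ'', μ' = μ'' + Finsupp.single b 1 :=
            ⟨μ' - Finsupp.single b 1, (tsub_add_cancel_of_le (by
              rw [Finsupp.single_le_iff]; omega)).symm⟩
          have hle : μ'' P ≤ (μ''.mapDomain τ) P := by
            rw [Finsupp.mapDomain, Finsupp.sum_fintype _ _ (by simp), Finsupp.finset_sum_apply]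
            refine le_trans ?_ (Finset.single_le_sum (fun _ _ => Nat.zero_le _) (Finset.mem_univ P))
            simp [hτP]
          have h2 : (μ''.mapDomain τ) P + 2 = k + 1 := by
            rw [hmd, Finsupp.mapDomain_add, Finsupp.mapDomain_single] at h
            have := DFunLike.congr_fun h P
            have hτb : τ b = P := by simp [τ, hbK]
            simp only [hτb, hν.1, Finsupp.add_apply, Finsupp.single_eq_same] at this
            omega
          have hμP : (μ'' + Finsupp.single b 1 + Finsupp.single a 1 : ι →₀ ℕ) P = μ'' P := by
            simp [Finsupp.single_apply, haK.1, hbK.1]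
          obtain ⟨a', ha'P, ha', hl⟩ := hμ (by rw [hμP]; omega)
          rw [hμP] at hl
          have hpa' : p a' = 0 := by
            by_contra h3
            have := (hp a' h3).2
            omega
          have hKa' : Kl a' := ⟨ha'P, by omega⟩
          rw [Finset.prod_eq_zero (Finset.mem_univ a'), mul_zero]
          simp only [w, hKa', if_true, hpa']
          exact zero_pow ha'
        · rfl
      · intro d _
        by_cases hpd : p d = 0
        · simp [hpd]
        · rw [if_neg, mul_zero]
          intro h
          have h5 : d = a := by
            by_contra hda
            have := DFunLike.congr_fun h a
            simp [hνKl a haK, Finsupp.single_apply, hda] at this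
          subst h5
          have := add_right_cancel h
          rw [this] at hb
          exact hb (hν' b hbK)

theorem coeff_shear {k : ℕ} {G : MvPolynomial ι R} (hG : InS P lam k G) (p : ι → R)
    (hp : ∀ a, p a ≠ 0 → a ≠ P ∧ lam a = k)
    (ν : ι →₀ ℕ) (hν : Bad P lam (k+1) ν) :
    coeff ν (Sub (shear P p) G) = coeff ν G +
      ∑ a, p a * coeff (ν - Finsupp.single P 1 + Finsupp.single a 1) G := by
  let ℓ : MvPolynomial ι R →ₗ[R] R := (lcoeff R ν) + ∑ a, p a • lcoeff R (ν - Finsupp.single P 1 + Finsupp.single a 1)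
  have hℓ : ∀ F, ℓ F = coeff ν F + ∑ a, p a * coeff (ν - Finsupp.single P 1 + Finsupp.single a 1) F := by
    intro F; simp [ℓ]
  rw [← hℓ]
  conv_lhs => rw [G.as_sum]
  conv_rhs => rw [G.as_sum]
  rw [map_sum, map_sum, coeff_sum]
  refine Finset.sum_congr rfl fun μ hμ => ?_
  rw [hℓ]
  exact coeff_shear_monomial P lam p hp ν hν μ (hG μ hμ) _

end Coeff
end MPC

namespace MPC
open MvPolynomial
theorem indep_of_mem {K Ω : Type u} [Field K] [Field Ω] [Algebra K Ω] {α β : Type} [Finite α] [Finite β]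
    (hcard : Nat.card β ≤ Nat.card α) (x : α → Ω) (hx : AlgebraicIndependent K x) (y : β → Ω)
    (h : ∀ a, x a ∈ IntermediateField.adjoin K (Set.range y)) : AlgebraicIndependent K y := by
  let F := IntermediateField.adjoin K (Set.range y)
  let y' : β → F := fun b => ⟨y b, IntermediateField.subset_adjoin K _ ⟨b, rfl⟩⟩
  let x' : α → F := fun a => ⟨x a, h a⟩
  have hx' : AlgebraicIndependent K x' := AlgebraicIndependent.of_comp F.val (by convert hx; rfl)
  have halg : Algebra.IsAlgebraic (Algebra.adjoin K (Set.range y')) F := by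
    constructor
    rintro ⟨z, hz⟩
    induction hz using IntermediateField.adjoin_induction with
    | mem z hz =>
      obtain ⟨b, rfl⟩ := hz
      exact isAlgebraic_algebraMap (⟨y' b, Algebra.subset_adjoin ⟨b, rfl⟩⟩ : Algebra.adjoin K (Set.range y'))
    | algebraMap r =>
      exact isAlgebraic_algebraMap (algebraMap K (Algebra.adjoin K (Set.range y')) r)
    | add x y hx hy h1 h2 => exact h1.add h2
    | inv x hx h1 => exact h1.inv
    | mul x y hx hy h1 h2 => exact h1.mul h2
  have := (Algebra.IsAlgebraic.isTranscendenceBasis_of_lift_le_trdeg_of_finite K y' (by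
    refine le_trans ?_ hx'.lift_cardinalMk_le_trdeg
    rw [← Nat.cast_card, ← Nat.cast_card]
    simpa using hcard)).1
  exact this.map' (f := F.val) Subtype.val_injective

theorem det_ne_zero_of_indep {K Ω : Type u} [Field K] [Field Ω] [Algebra K Ω] {n : Type} [Fintype n] [DecidableEq n]
    (M : Matrix n n Ω) (h : AlgebraicIndependent K fun p : n × n => M p.1 p.2) : M.det ≠ 0 := by
  have := Matrix.mvPolynomialX_mapMatrix_aeval K M
  rw [← this, ← AlgHom.map_det]
  intro h0
  exact Matrix.det_mvPolynomialX_ne_zero n K ((map_eq_zero_iff _ h).1 h0)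

section Forward
variable {ι : Type} [Fintype ι] [DecidableEq ι] (P : ι) (lam : ι → ℕ) {m : ℕ} (dv : Fin m → ℕ)

/-- Monomials allowed at stage `k`. -/
def Idx (k : ℕ) : Type := {p : Fin m × (ι →₀ ℕ) // p.2.degree = dv p.1 ∧ Good P lam k p.2}

/-- Monomials to be killed at stage `k`. -/
def Row (k : ℕ) : Type := {p : Fin m × (ι →₀ ℕ) // p.2.degree = dv p.1 ∧ Bad P lam k p.2}

theorem finite_deg (Q : (ι →₀ ℕ) → Prop) :
    Finite {p : Fin m × (ι →₀ ℕ) // p.2.degree = dv p.1 ∧ Q p.2} := by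
  let D := ∑ j, dv j
  have hD : ∀ j, dv j ≤ D := fun j => Finset.single_le_sum (fun _ _ => Nat.zero_le _) (Finset.mem_univ j)
  let f : {p : Fin m × (ι →₀ ℕ) // p.2.degree = dv p.1 ∧ Q p.2} → Fin m × (ι → Fin (D + 1)) :=
    fun p => (p.1.1, fun i => ⟨p.1.2 i, by
      have := Finsupp.le_degree i p.1.2
      have := p.2.1
      have := hD p.1.1
      omega⟩)
  refine Finite.of_injective f ?_
  rintro ⟨⟨j, μ⟩, h⟩ ⟨⟨j', μ'⟩, h'⟩ heq
  simp only [f, Prod.mk.injEq] at heq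
  obtain ⟨rfl, h2⟩ := heq
  have : μ = μ' := by
    ext i
    have := congrFun h2 i
    simpa using this
  subst this
  rfl

instance (k : ℕ) : Finite (Idx P lam dv k) := finite_deg dv _
instance (k : ℕ) : Finite (Row P lam dv k) := finite_deg dv _

theorem card_Idx (k : ℕ) : Nat.card (Idx P lam dv k) =
    Nat.card (Row P lam dv (k+1)) + Nat.card (Idx P lam dv (k+1)) := by
  classical
  rw [← Nat.card_sum]
  refine Nat.card_congr ?_
  refine (Equiv.subtypeEquivRight ?_).trans (subtypeOrEquiv
    (fun p : Fin m × (ι →₀ ℕ) => p.2.degree = dv p.1 ∧ Bad P lam (k+1) p.2)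
    (fun p : Fin m × (ι →₀ ℕ) => p.2.degree = dv p.1 ∧ Good P lam (k+1) p.2) ?_)
  · intro p
    rw [good_iff]
    tauto
  · rw [Pi.disjoint_iff]
    intro p
    rw [Prop.disjoint_iff, not_and]
    intro h h'
    exact not_good_of_bad P lam _ _ h.2 h'.2

/-- The system of polynomials with given coefficients. -/
noncomputable def polyOf {R : Type*} [CommRing R] {k : ℕ} (b : Idx P lam dv k → R) (j : Fin m) : MvPolynomial ι R :=
  ∑ᶠ i : Idx P lam dv k, if i.1.1 = j then monomial i.1.2 (b i) else 0

theorem coeff_polyOf {R : Type*} [CommRing R] {k : ℕ} (b : Idx P lam dv k → R) (j : Fin m) (μ : ι →₀ ℕ)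
    (h : μ.degree = dv j ∧ Good P lam k μ) : coeff μ (polyOf P lam dv b j) = b ⟨(j, μ), h⟩ := by
  classical
  have := Fintype.ofFinite (Idx P lam dv k)
  rw [polyOf, finsum_eq_sum_of_fintype, coeff_sum, Finset.sum_eq_single ⟨(j, μ), h⟩]
  · simp
  · rintro ⟨⟨j', μ'⟩, h'⟩ _ hne
    split_ifs with h1
    · rw [coeff_monomial, if_neg]
      rintro h2
      simp only at h1 h2
      subst h1 h2
      exact hne rfl
    · simp
  · intro h1; exact absurd (Finset.mem_univ _) h1

theorem coeff_polyOf_not {R : Type*} [CommRing R] {k : ℕ} (b : Idx P lam dv k → R) (j : Fin m) (μ : ι →₀ ℕ)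
    (h : ¬ (μ.degree = dv j ∧ Good P lam k μ)) : coeff μ (polyOf P lam dv b j) = 0 := by
  classical
  have := Fintype.ofFinite (Idx P lam dv k)
  rw [polyOf, finsum_eq_sum_of_fintype, coeff_sum]
  refine Finset.sum_eq_zero ?_
  rintro ⟨⟨j', μ'⟩, h'⟩ _
  split_ifs with h1
  · rw [coeff_monomial, if_neg]
    rintro h2
    simp only at h1 h2
    subst h1 h2
    exact h h'
  · simp

theorem map_polyOf {R S : Type*} [CommRing R] [CommRing S] {k : ℕ} (f : R →+* S)
    (b : Idx P lam dv k → R) (G : MvPolynomial ι S) (j : Fin m) (hG : G.IsHomogeneous (dv j)) (hS : InS P lam k G)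
    (h : ∀ μ h, f (b ⟨(j, μ), h⟩) = coeff μ G) : map f (polyOf P lam dv b j) = G := by
  ext μ
  rw [coeff_map]
  by_cases h1 : μ.degree = dv j ∧ Good P lam k μ
  · rw [coeff_polyOf P lam dv b j μ h1, h]
  · rw [coeff_polyOf_not P lam dv b j μ h1, map_zero]
    by_contra h2
    have h2 := Ne.symm h2
    refine h1 ⟨?_, hS μ (mem_support_iff.2 h2)⟩
    by_contra h3
    exact h2 (hG.coeff_eq_zero h3)

theorem eval_single_eq_zero {R : Type*} [CommRing R] {D d : ℕ} (hd : d ≤ D) {G : MvPolynomial ι R}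
    (hG : G.IsHomogeneous d) (hS : InS P lam D G) : eval (Pi.single P 1) G = 0 := by
  rw [eval_eq']
  refine Finset.sum_eq_zero fun μ hμ => ?_
  have hdeg : μ.degree = d := by
    by_contra h
    exact (mem_support_iff.1 hμ) (hG.coeff_eq_zero h)
  obtain ⟨a, ha, ha', _⟩ := hS μ hμ (by
    have := Finsupp.le_degree P μ
    omega)
  rw [Finset.prod_eq_zero (Finset.mem_univ a), mul_zero]
  rw [Pi.single_eq_of_ne ha, zero_pow ha']

theorem shear_map {R S : Type*} [CommRing R] [CommRing S] (f : R →+* S) (p : ι → R) :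
    (shear P p).map f = shear P (fun i => f (p i)) := by
  ext i j
  simp only [shear, Matrix.map_apply, Matrix.add_apply, Matrix.of_apply, map_add, Matrix.one_apply]
  congr 1 <;> split_ifs <;> simp

def HasLift {K Ω E : Type u} [Field K] [Field Ω] [Field E] [Algebra K Ω] [Algebra K E] {T : Type}
    (e : T → Ω) (G : Fin m → MvPolynomial ι Ω) (v : ι → Ω) (e0 : T → E) (G0 : Fin m → MvPolynomial ι E) 
    (v0 : ι → E) : Prop :=
  ∃ (L : Type u) (_ : CommRing L) (_ : Algebra K L) (c : L →ₐ[K] Ω) (σ : L →ₐ[K] E)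
    (e' : T → L) (G' : Fin m → MvPolynomial ι L) (v' : ι → L),
    Function.Injective c ∧ (∀ x, σ x ≠ 0 → IsUnit x) ∧
    (∀ t, c (e' t) = e t) ∧ (∀ j, map (c : L →+* Ω) (G' j) = G j) ∧ (∀ i, c (v' i) = v i) ∧
    (∀ t, σ (e' t) = e0 t) ∧ (∀ j, map (σ : L →+* E) (G' j) = G0 j) ∧ (∀ i, σ (v' i) = v0 i)

theorem exists_local {K Ω E : Type u} [Field K] [Field Ω] [Field E] [Algebra K Ω] [Algebra K E] {B : Type}
    (b : B → Ω) (hb : AlgebraicIndependent K b) (b0 : B → E) :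
    ∃ (L : Type u) (_ : CommRing L) (_ : Algebra K L) (c : L →ₐ[K] Ω) (σ : L →ₐ[K] E)
    (b' : B → L), Function.Injective c ∧ (∀ x, σ x ≠ 0 → IsUnit x) ∧
    (∀ t, c (b' t) = b t) ∧ (∀ t, σ (b' t) = b0 t) := by
  let σ' : MvPolynomial B K →ₐ[K] E := aeval b0
  let c' : MvPolynomial B K →ₐ[K] Ω := aeval b
  have hc' : Function.Injective c' := hb
  let p : Ideal (MvPolynomial B K) := RingHom.ker σ'
  have hp : p.IsPrime := RingHom.ker_isPrime _
  have hne : ∀ y : p.primeCompl, σ' y ≠ 0 := fun y h => y.2 h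
  have hσu : ∀ y : p.primeCompl, IsUnit (σ' y) := fun y => (hne y).isUnit
  have hcu : ∀ y : p.primeCompl, IsUnit (c' y) := fun y => by
    refine IsUnit.mk0 _ fun h => hne y ?_
    rw [(map_eq_zero_iff c' hc').1 h, map_zero]
  let c : Localization.AtPrime p →ₐ[K] Ω := IsLocalization.liftAlgHom (M := p.primeCompl) (f := c') hcu
  let σ : Localization.AtPrime p →ₐ[K] E := IsLocalization.liftAlgHom (M := p.primeCompl) (f := σ') hσu
  have hcX : ∀ a, c (algebraMap _ _ a) = c' a := fun a => IsLocalization.lift_eq (M := p.primeCompl) (g := c'.toRingHom) hcu a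
  have hσX : ∀ a, σ (algebraMap _ _ a) = σ' a := fun a => IsLocalization.lift_eq (M := p.primeCompl) (g := σ'.toRingHom) hσu a
  refine ⟨Localization.AtPrime p, inferInstance, inferInstance, c, σ,
    fun t => algebraMap (MvPolynomial B K) _ (X t), ?_, ?_, ?_, ?_⟩
  · rw [injective_iff_map_eq_zero]
    intro x hx
    obtain ⟨a, s, rfl⟩ := IsLocalization.exists_mk'_eq p.primeCompl x
    have := congrArg c (IsLocalization.mk'_spec (Localization.AtPrime p) a s)
    rw [map_mul, hx, zero_mul, hcX] at this
    rw [(map_eq_zero_iff c' hc').1 this.symm]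
    simp
  · intro x hx
    obtain ⟨a, s, rfl⟩ := IsLocalization.exists_mk'_eq p.primeCompl x
    have := congrArg σ (IsLocalization.mk'_spec (Localization.AtPrime p) a s)
    rw [map_mul, hσX, hσX] at this
    have ha : a ∈ p.primeCompl := by
      intro h
      have h2 : σ' a = 0 := h
      rw [h2] at this
      exact (mul_ne_zero hx (hne s)) this
    have h3 : IsUnit (algebraMap _ (Localization.AtPrime p) a) := IsLocalization.map_units _ (⟨a, ha⟩ : p.primeCompl)
    rw [← IsLocalization.mk'_spec (Localization.AtPrime p) a s] at h3
    exact isUnit_of_mul_isUnit_left h3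
  · intro t; rw [hcX]; simp [c']
  · intro t; rw [hσX]; simp [σ']

end Forward
end MPC

namespace MPC
open MvPolynomial
section Forward
variable {ι : Type} [Fintype ι] [DecidableEq ι] (P : ι) (lam : ι → ℕ) {m : ℕ} (dv : Fin m → ℕ)

theorem map_extend {R S : Type*} [CommRing R] [CommRing S] (f : R →+* S) {A : Type*} (π : A → ι)
    (hπ : Function.Injective π) (p : A → R) (i : ι) :
    f (Function.extend π p 0 i) = Function.extend π (fun a => f (p a)) 0 i := by
  by_cases h : ∃ a, π a = i
  · obtain ⟨a, rfl⟩ := h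
    rw [hπ.extend_apply, hπ.extend_apply]
  · rw [Function.extend_apply' _ _ _ h, Function.extend_apply' _ _ _ h]
    simp

theorem coeff_mem_of {K Ω : Type u} [Field K] [Field Ω] [Algebra K Ω] (F : IntermediateField K Ω) {k : ℕ}
    {G : MvPolynomial ι Ω} {j : Fin m} (hG : G.IsHomogeneous (dv j)) (hS : InS P lam k G)
    (h : ∀ μ, (μ.degree = dv j ∧ Good P lam k μ) → coeff μ G ∈ F) (μ : ι →₀ ℕ) : coeff μ G ∈ F := by
  by_cases h2 : coeff μ G = 0
  · rw [h2]; exact F.zero_mem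
  · refine h μ ⟨?_, hS μ (mem_support_iff.2 h2)⟩
    by_contra h3
    exact h2 (hG.coeff_eq_zero h3)

theorem forward {K : Type u} [Field K] {D : ℕ} (hD : ∀ j, dv j ≤ D)
    (hpiv : ∀ k < D, ∃ π : Row P lam dv (k+1) → ι, Function.Injective π ∧ ∀ ρ, π ρ ≠ P ∧ lam (π ρ) = k)
    {Ω : Type u} [Field Ω] [Algebra K Ω] (n : ℕ) :
    ∀ (k : ℕ) (hnk : n + k = D) (T : Type) [Finite T] (e : T → Ω) (G : Fin m → MvPolynomial ι Ω)
      (hG : ∀ j, (G j).IsHomogeneous (dv j)) (hS : ∀ j, InS P lam k (G j))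
      (hind : AlgebraicIndependent K (Sum.elim e (fun i : Idx P lam dv k => coeff i.1.2 (G i.1.1)))),
      ∃ v : ι → Ω, (∀ j, eval v (G j) = 0) ∧
        ∀ (E : Type u) [Field E] [Algebra K E] (e0 : T → E) (G0 : Fin m → MvPolynomial ι E)
          (hG0 : ∀ j, (G0 j).IsHomogeneous (dv j)) (hS0 : ∀ j, InS P lam D (G0 j)),
          HasLift (K := K) e G v e0 G0 (Pi.single P 1) := by
  induction n with
  | zero =>
    intro k hnk T _ e G hG hS hind
    obtain rfl : k = D := by omega
    refine ⟨Pi.single P 1, fun j => eval_single_eq_zero P lam (hD j) (hG j) (hS j), ?_⟩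
    intro E _ _ e0 G0 hG0 hS0
    obtain ⟨L, i1, i2, c, σ, b', hc, hu, hb, hb0⟩ := exists_local _ hind
      (Sum.elim e0 (fun i : Idx P lam dv k => coeff i.1.2 (G0 i.1.1)))
    refine ⟨L, i1, i2, c, σ, fun t => b' (Sum.inl t), polyOf P lam dv (fun i => b' (Sum.inr i)),
      Pi.single P 1, hc, hu, fun t => by simp [hb], ?_, ?_, fun t => by simp [hb0], ?_, ?_⟩
    · intro j
      exact map_polyOf P lam dv _ _ _ j (hG j) (hS j) (fun μ h => hb _)
    · intro i
      by_cases h : i = P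
      · subst h; simp
      · simp [Pi.single_eq_of_ne h]
    · intro j
      exact map_polyOf P lam dv _ _ _ j (hG0 j) (hS0 j) (fun μ h => hb0 _)
    · intro i
      by_cases h : i = P
      · subst h; simp
      · simp [Pi.single_eq_of_ne h]
  | succ n ih =>
    intro k hnk T _ e G hG hS hind
    classical
    obtain ⟨π, hπ, hπP⟩ := hpiv k (by omega)
    have := Fintype.ofFinite (Row P lam dv (k+1))
    let M : Matrix (Row P lam dv (k+1)) (Row P lam dv (k+1)) Ω := Matrix.of fun ν ρ =>
      coeff (ν.1.2 - Finsupp.single P 1 + Finsupp.single (π ρ) 1) (G ν.1.1)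
    have hle : ∀ ν : Row P lam dv (k+1), Finsupp.single P 1 ≤ ν.1.2 := fun ν => by
      rw [Finsupp.single_le_iff, ν.2.2.1]; omega
    have hM : M.det ≠ 0 := by
      apply det_ne_zero_of_indep (K := K)
      let f : Row P lam dv (k+1) × Row P lam dv (k+1) → T ⊕ Idx P lam dv k := fun q =>
        Sum.inr ⟨(q.1.1.1, q.1.1.2 - Finsupp.single P 1 + Finsupp.single (π q.2) 1), by
          constructor
          · have := q.1.2.1
            simp only [map_add, Finsupp.degree_single] at *
            rw [← this]
            conv_rhs => rw [← tsub_add_cancel_of_le (hle q.1)]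
            simp
          · intro _
            refine ⟨π q.2, (hπP _).1, by simp, ?_⟩
            rw [(hπP _).2]
            have := q.1.2.2.1
            simp [(hπP q.2).1, this, Finsupp.single_apply]⟩
      have hf : Function.Injective f := by
        rintro ⟨ν, ρ⟩ ⟨ν', ρ'⟩ h
        have h := congrArg Subtype.val (Sum.inr_injective h)
        simp only [Prod.mk.injEq] at h
        obtain ⟨h1, h2⟩ := h
        have h3 : π ρ = π ρ' := by
          by_contra hne
          have := DFunLike.congr_fun h2 (π ρ)
          have h0 : ν'.1.2 (π ρ) = 0 := by
            by_contra h0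
            have := ν'.2.2.2 _ (hπP ρ).1 h0
            have := (hπP ρ).2
            omega
          simp [h0, Finsupp.single_apply, Ne.symm hne] at this
        have h4 : ρ = ρ' := hπ h3
        subst h4
        have h5 := add_right_cancel h2
        have h6 : ν.1.2 = ν'.1.2 := by
          rw [← tsub_add_cancel_of_le (hle ν), h5, tsub_add_cancel_of_le (hle ν')]
        have : ν = ν' := Subtype.ext (Prod.ext h1 h6)
        rw [this]
      exact hind.comp f hf
    let pR : Row P lam dv (k+1) → Ω := M⁻¹.mulVec (fun ν => - coeff ν.1.2 (G ν.1.1))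
    have hpR : M.mulVec pR = fun ν => - coeff ν.1.2 (G ν.1.1) := by
      simp only [pR]
      rw [Matrix.mulVec_mulVec, Matrix.mul_nonsing_inv _ (isUnit_iff_ne_zero.2 hM), Matrix.one_mulVec]
    let p : ι → Ω := Function.extend π pR 0
    have hp : ∀ a, p a ≠ 0 → a ≠ P ∧ lam a = k := by
      intro a ha
      by_cases h : ∃ ρ, π ρ = a
      · obtain ⟨ρ, rfl⟩ := h
        exact hπP ρ
      · exact absurd (Function.extend_apply' _ _ _ h) ha
    have hpP : p P = 0 := by
      by_contra h
      exact (hp P h).1 rfl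
    let G' : Fin m → MvPolynomial ι Ω := fun j => Sub (shear P p) (G j)
    have hG' : ∀ j, (G' j).IsHomogeneous (dv j) := fun j => Sub_homog _ (hG j)
    have hS' : ∀ j, InS P lam (k+1) (G' j) := by
      intro j
      apply inS_succ P lam (inS_Sub_shear P lam (hS j) p hp)
      intro μ hμ
      by_cases hdeg : μ.degree = dv j
      · let ν : Row P lam dv (k+1) := ⟨(j, μ), hdeg, hμ⟩
        rw [coeff_shear P lam (hS j) p hp μ hμ]
        have h1 := congrFun hpR ν
        have h2 : ∑ a, p a * coeff (μ - Finsupp.single P 1 + Finsupp.single a 1) (G j) = M.mulVec pR ν := by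
          symm
          rw [Matrix.mulVec, dotProduct]
          apply Fintype.sum_of_injective π hπ
          · intro a ha
            have : p a = 0 := Function.extend_apply' _ _ _ ha
            rw [this, zero_mul]
          · intro ρ
            rw [mul_comm]
            have : p (π ρ) = pR ρ := hπ.extend_apply _ _ _
            rw [this]
            rfl
        rw [h2, h1]
        simp [ν]
      · exact (hG' j).coeff_eq_zero hdeg
    have hback : ∀ j, Sub (shear P (-p)) (G' j) = G j := fun j => Sub_shear_neg P p hpP (G j)
    have hind' : AlgebraicIndependent K (Sum.elim (Sum.elim e pR)
        (fun i : Idx P lam dv (k+1) => coeff i.1.2 (G' i.1.1))) := by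
      refine indep_of_mem ?_ _ hind _ ?_
      · have := card_Idx P lam dv k
        simp only [Nat.card_sum]
        omega
      · set y := (Sum.elim (Sum.elim e pR) (fun i : Idx P lam dv (k+1) => coeff i.1.2 (G' i.1.1))) with hy
        have hyF : ∀ b, y b ∈ IntermediateField.adjoin K (Set.range y) := fun b =>
          IntermediateField.subset_adjoin K _ ⟨b, rfl⟩
        rintro (t | ⟨⟨j, μ⟩, h⟩)
        · exact hyF (Sum.inl (Sum.inl t))
        · change coeff μ (G j) ∈ _
          rw [← hback j]
          apply coeff_Sub_mem
          · intro i i'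
            simp only [shear, Matrix.add_apply, Matrix.of_apply, Matrix.one_apply]
            refine add_mem ?_ ?_
            · split_ifs
              · exact one_mem _
              · exact zero_mem _
            · split_ifs
              · rw [Pi.neg_apply]
                refine neg_mem ?_
                by_cases hh : ∃ ρ, π ρ = i
                · obtain ⟨ρ, rfl⟩ := hh
                  have : p (π ρ) = pR ρ := hπ.extend_apply _ _ _
                  rw [this]
                  exact hyF (Sum.inl (Sum.inr ρ))
                · have : p i = 0 := Function.extend_apply' _ _ _ hh
                  rw [this]
                  exact zero_mem _
              · exact zero_mem _
          · refine coeff_mem_of P lam dv _ (hG' j) (hS' j) ?_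
            intro μ' hμ'
            exact hyF (Sum.inr ⟨(j, μ'), hμ'⟩)
    obtain ⟨v', hv', hlift⟩ := ih (k+1) (by omega) (T ⊕ Row P lam dv (k+1)) (Sum.elim e pR) G' hG' hS' hind'
    refine ⟨(shear P p).mulVec v', ?_, ?_⟩
    · intro j
      rw [← eval_Sub]
      exact hv' j
    · intro E _ _ e0 G0 hG0 hS0
      obtain ⟨L, i1, i2, c, σ, el, Gl, vl, hc, hu, h1, h2, h3, h4, h5, h6⟩ :=
        hlift E (Sum.elim e0 0) G0 hG0 hS0
      let pl : ι → L := Function.extend π (fun ρ => el (Sum.inr ρ)) 0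
      have hcp : ∀ i, c (pl i) = p i := by
        intro i
        have := map_extend (c : L →+* Ω) π hπ (fun ρ => el (Sum.inr ρ)) i
        refine this.trans ?_
        simp only [RingHom.coe_coe, h1]
        rfl
      have hσp : ∀ i, σ (pl i) = 0 := by
        intro i
        have := map_extend (σ : L →+* E) π hπ (fun ρ => el (Sum.inr ρ)) i
        refine this.trans ?_
        simp only [RingHom.coe_coe, h4]
        by_cases hh : ∃ ρ, π ρ = i
        · obtain ⟨ρ, rfl⟩ := hh
          rw [hπ.extend_apply]; rfl
        · rw [Function.extend_apply' _ _ _ hh]; rfl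
      refine ⟨L, i1, i2, c, σ, fun t => el (Sum.inl t), fun j => Sub (shear P (-pl)) (Gl j),
        (shear P pl).mulVec vl, hc, hu, fun t => h1 _, ?_, ?_, fun t => h4 _, ?_, ?_⟩
      · intro j
        rw [map_Sub, h2, shear_map, ← hback j]
        congr 3
        funext i
        simp [hcp]
      · intro i
        have := RingHom.map_mulVec (c : L →+* Ω) (shear P pl) vl i
        refine this.trans ?_
        rw [shear_map]
        congr 2
        · congr 1; funext i; exact hcp i
        · funext i; exact h3 i
      · intro j
        rw [map_Sub, h5, shear_map]
        have : (fun i => (σ : L →+* E) ((-pl) i)) = 0 := by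
          funext i; simp [hσp]
        rw [this, shear_zero, Sub_one]
      · intro i
        have := RingHom.map_mulVec (σ : L →+* E) (shear P pl) vl i
        refine this.trans ?_
        rw [shear_map]
        have h7 : (fun i => (σ : L →+* E) (pl i)) = 0 := by
          funext i; simp [hσp]
        rw [h7, shear_zero, Matrix.one_mulVec]
        exact h6 i

end Forward
end MPC

namespace MPC
open MvPolynomial
section Back
variable {ι : Type} [Fintype ι] [DecidableEq ι] (P : ι) (lam : ι → ℕ) 

theorem homog_aeval_smul {R S : Type*} [CommRing R] [CommRing S] [Algebra R S] {G : MvPolynomial ι R} {d : ℕ}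
    (hG : G.IsHomogeneous d) (s : S) (x : ι → S) :
    aeval (fun i => s * x i) G = s ^ d * aeval x G := by
  rw [aeval_def, aeval_def, eval₂_eq', eval₂_eq', Finset.mul_sum]
  refine Finset.sum_congr rfl fun μ hμ => ?_
  have hdeg : μ.degree = d := by
    by_contra h
    exact (mem_support_iff.1 hμ) (hG.coeff_eq_zero h)
  have : ∏ i, (s * x i) ^ μ i = s ^ d * ∏ i, x i ^ μ i := by
    simp only [mul_pow, Finset.prod_mul_distrib, Finset.prod_pow_eq_pow_sum]
    rw [← Finsupp.degree_eq_sum, hdeg]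
  rw [this]; ring

theorem exists_extend_matrix {E : Type*} [Field E] {Z : Type*} [Fintype Z] [DecidableEq Z] (p : Z → Prop)
    (v : {a // p a} → Z → E) (hv : LinearIndependent E v) :
    ∃ B : Matrix Z Z E, B.det ≠ 0 ∧ ∀ (a : {a // p a}) i, B i a = v a i := by
  classical
  let b := Module.Basis.sumExtend hv
  have : Fintype ({a // p a} ⊕ Module.Basis.sumExtendIndex hv) := FiniteDimensional.fintypeBasisIndex b
  have : Finite (Module.Basis.sumExtendIndex hv) := Finite.of_injective _ Sum.inr_injective (β := {a // p a} ⊕ Module.Basis.sumExtendIndex hv)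
  have hc : Nat.card ({a // p a} ⊕ Module.Basis.sumExtendIndex hv) = Nat.card Z := by
    rw [Nat.card_eq_fintype_card, Nat.card_eq_fintype_card, ← Module.finrank_eq_card_basis b]; simp
  have hc2 : Nat.card ({a // p a} ⊕ {a // ¬ p a}) = Nat.card Z := Nat.card_congr (Equiv.sumCompl p)
  rw [Nat.card_sum] at hc hc2
  have hc3 : Nat.card {a // ¬ p a} = Nat.card (Module.Basis.sumExtendIndex hv) := by omega
  let f : {a // ¬ p a} ≃ Module.Basis.sumExtendIndex hv := (Finite.equivFinOfCardEq hc3).trans (Finite.equivFin _).symm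
  let g : Z ≃ {a // p a} ⊕ Module.Basis.sumExtendIndex hv :=
    (Equiv.sumCompl p).symm.trans (Equiv.sumCongr (Equiv.refl _) f)
  let B : Matrix Z Z E := Matrix.of fun i j => b (g j) i
  refine ⟨B, ?_, ?_⟩
  · have : LinearIndependent E B.col := b.linearIndependent.comp g g.injective
    rw [Matrix.linearIndependent_cols_iff_isUnit, Matrix.isUnit_iff_isUnit_det] at this
    exact this.ne_zero
  · intro a i
    have : g a = Sum.inl a := by simp [g]
    simp only [B, Matrix.of_apply, this]
    simp [b, Module.Basis.sumExtend]
    rfl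

/-- Coefficient of `t^e` of `F(t P + x)`, with `x` supported in `lam > l`, as a polynomial in `x`. -/
noncomputable def cf {E : Type*} [CommRing E] (l e : ℕ) (F : MvPolynomial ι E) : MvPolynomial ι E :=
  open Classical in
  ∑ μ ∈ F.support.filter (fun μ => μ P = e ∧ ∀ a, a ≠ P → μ a ≠ 0 → l < lam a),
    monomial (μ.erase P) (coeff μ F)

noncomputable def qv {E : Type*} [CommRing E] (l : ℕ) (x : ι → E) (i : ι) : Polynomial E :=
  if i = P then Polynomial.X else if l < lam i then Polynomial.C (x i) else 0

theorem eval_cf {E : Type*} [CommRing E] (l e : ℕ) (F : MvPolynomial ι E) (x : ι → E) :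
    eval x (cf P lam l e F) = (aeval (qv P lam l x) F : Polynomial E).coeff e := by
  classical
  rw [aeval_def, eval₂_eq', cf, map_sum, Polynomial.finset_sum_coeff, Finset.sum_filter]
  refine Finset.sum_congr rfl fun μ hμ => ?_
  rw [← Finset.mul_prod_erase _ _ (Finset.mem_univ P)]
  have hP : qv P lam l x P = Polynomial.X := by simp [qv]
  rw [hP]
  by_cases h : ∀ a, a ≠ P → μ a ≠ 0 → l < lam a
  · have h1 : ∏ i ∈ Finset.univ.erase P, qv P lam l x i ^ μ i =
        Polynomial.C (∏ i ∈ Finset.univ.erase P, x i ^ μ i) := by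
      rw [map_prod]
      refine Finset.prod_congr rfl fun i hi => ?_
      have hi := Finset.ne_of_mem_erase hi
      by_cases h0 : μ i = 0
      · simp [h0]
      · simp [qv, hi, h i hi h0]
    have h2 : eval x (monomial (μ.erase P) (coeff μ F)) = coeff μ F * ∏ i ∈ Finset.univ.erase P, x i ^ μ i := by
      rw [eval_monomial, Finsupp.prod_fintype _ _ (by simp), ← Finset.mul_prod_erase _ _ (Finset.mem_univ P)]
      simp only [Finsupp.erase_same, pow_zero, one_mul]
      congr 1
      refine Finset.prod_congr rfl fun i hi => ?_
      rw [Finsupp.erase_ne (Finset.ne_of_mem_erase hi)]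
    rw [h1, h2]
    rw [show (algebraMap E (Polynomial E) (coeff μ F) * (Polynomial.X ^ μ P * Polynomial.C (∏ i ∈ Finset.univ.erase P, x i ^ μ i))) =
      Polynomial.C (coeff μ F * ∏ i ∈ Finset.univ.erase P, x i ^ μ i) * Polynomial.X ^ μ P by
        rw [map_mul, Polynomial.algebraMap_eq]; ring, Polynomial.coeff_C_mul_X_pow]
    by_cases h3 : μ P = e
    · rw [if_pos ⟨h3, h⟩, if_pos h3.symm]
    · rw [if_neg (fun h' => h3 h'.1), if_neg (Ne.symm h3)]
  · rw [if_neg (fun h' => h h'.2)]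
    push Not at h
    obtain ⟨a, ha, ha', hl⟩ := h
    rw [Finset.prod_eq_zero (Finset.mem_erase.2 ⟨ha, Finset.mem_univ a⟩)]
    · simp
    · simp only [qv, if_neg ha, if_neg (not_lt.2 hl)]
      exact zero_pow ha'

theorem coeff_of_cf_eq_zero {E : Type*} [CommRing E] (l e : ℕ) (F : MvPolynomial ι E) (h0 : cf P lam l e F = 0)
    (ν : ι →₀ ℕ) (h1 : ν P = e) (h2 : ∀ a, a ≠ P → ν a ≠ 0 → l < lam a) : coeff ν F = 0 := by
  classical
  by_contra hne
  have h3 : coeff (ν.erase P) (cf P lam l e F) = coeff ν F := by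
    rw [cf, coeff_sum, Finset.sum_eq_single ν]
    · simp
    · intro μ hμ hne
      rw [coeff_monomial, if_neg]
      intro h
      apply hne
      ext i
      by_cases hi : i = P
      · subst hi
        rw [h1, (Finset.mem_filter.1 hμ).2.1]
      · have := DFunLike.congr_fun h i
        rwa [Finsupp.erase_ne hi, Finsupp.erase_ne hi] at this
    · intro h
      exact absurd (Finset.mem_filter.2 ⟨mem_support_iff.2 hne, h1, h2⟩) h
  rw [h0, coeff_zero] at h3
  exact hne h3.symm

theorem cf_homog {E : Type*} [CommRing E] (l e : ℕ) {F : MvPolynomial ι E} {d : ℕ} (hF : F.IsHomogeneous d) :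
    (cf P lam l e F).IsHomogeneous (d - e) := by
  classical
  refine IsHomogeneous.sum _ _ _ fun μ hμ => ?_
  apply isHomogeneous_monomial
  rw [Finset.mem_filter] at hμ
  have hdeg : μ.degree = d := by
    by_contra h
    exact (mem_support_iff.1 hμ.1) (hF.coeff_eq_zero h)
  have h2 : (Finsupp.single P (μ P) + μ.erase P).degree = d := by
    rw [Finsupp.single_add_erase, hdeg]
  rw [map_add, Finsupp.degree_single, hμ.2.1] at h2
  omega

theorem stepC {E : Type u} [Field E] [IsAlgClosed E] {m D k : ℕ} (hlP : lam P = 0) (dv : Fin m → ℕ) (hD : ∀ j, dv j ≤ D)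
    (hcard : m * (D + 1) ^ (Fintype.card {i // k + 1 < lam i}) + Fintype.card {i // k + 1 < lam i} <
      Fintype.card {i // k < lam i})
    (G : Fin m → MvPolynomial ι E) (hG : ∀ j, (G j).IsHomogeneous (dv j)) (hS : ∀ j, InS P lam k (G j))
    (hP : ∀ j, eval (Pi.single P 1) (G j) = 0) :
    ∃ h : Matrix ι ι E, h.det ≠ 0 ∧ (∀ i j, lam j ≤ k → h i j = (1 : Matrix ι ι E) i j) ∧
      (∀ i j, lam i ≤ k → h i j = (1 : Matrix ι ι E) i j) ∧ ∀ j, InS P lam (k+1) (Sub h (G j)) := by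
  classical
  let f : Fin m → MvPolynomial ι E := fun j => cf P lam k (k+1) (G j)
  obtain ⟨v, hv, hvZ, hv0⟩ := lin D m (Finset.univ.filter fun i => k < lam i) f
    (fun j => (cf_homog P lam k (k+1) (hG j)).totalDegree_le.trans (by have := hD j; omega))
    (fun j z s hs h => by
      have := homog_aeval_smul (cf_homog P lam k (k+1) (hG j)) s z
      rw [← coe_aeval_eq_eval] at h ⊢
      simp only [RingHom.coe_coe] at h ⊢
      refine this.trans ?_
      rw [h, mul_zero])
    (fun j => by
      simp only [f]
      rw [eval_cf]
      have h1 : qv P lam k (0 : ι → E) = fun i => Polynomial.X * (algebraMap E (Polynomial E)) ((Pi.single P 1 : ι → E) i) := by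
        funext i
        by_cases hi : i = P
        · subst hi; simp [qv]
        · simp [qv, hi]
      rw [h1, homog_aeval_smul (hG j)]
      have : aeval (fun i => (algebraMap E (Polynomial E)) ((Pi.single P 1 : ι → E) i)) (G j) = 0 := by
        refine (aeval_algebraMap_apply (Polynomial E) (Pi.single P 1 : ι → E) (G j)).trans ?_
        have h2 := hP j
        rw [← coe_aeval_eq_eval] at h2
        simp only [RingHom.coe_coe] at h2
        rw [h2, map_zero]
      rw [this, mul_zero, Polynomial.coeff_zero])
    (Fintype.card {i // k + 1 < lam i}) (by
      rw [Fintype.card_subtype] at hcard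
      rw [Fintype.card_subtype] at *
      exact hcard)
  let g : {i // k + 1 < lam i} ≃ Fin (Fintype.card {i // k + 1 < lam i}) := Fintype.equivFin _
  let Z := {i // k < lam i}
  have hvZ' : ∀ a (i : ι), ¬ (k < lam i) → v a i = 0 := fun a i hi => hvZ a i (by simpa using hi)
  let w : {a : Z // k + 1 < lam a.1} → Z → E := fun a i => v (g ⟨a.1.1, a.2⟩) i.1
  have hw : LinearIndependent E w := by
    have h1 : LinearIndependent E (fun a : Fin (Fintype.card {i // k + 1 < lam i}) => fun i : Z => v a i.1) := by
      rw [Fintype.linearIndependent_iff] at hv ⊢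
      intro c hc
      apply hv c
      funext i
      by_cases hi : k < lam i
      · have := congrFun hc ⟨i, hi⟩
        simpa [Finset.sum_apply] using this
      · simp [Finset.sum_apply, hvZ' _ i hi]
    refine h1.comp (fun a : {a : Z // k + 1 < lam a.1} => g ⟨a.1.1, a.2⟩) ?_
    intro a b hab
    have := g.injective hab
    have h3 := congrArg Subtype.val this
    exact Subtype.ext (Subtype.ext h3)
  obtain ⟨B, hB, hBw⟩ := exists_extend_matrix (fun a : Z => k + 1 < lam a.1) w hw
  let h : Matrix ι ι E := Matrix.of fun i j =>
    if hij : k < lam i ∧ k < lam j then B ⟨i, hij.1⟩ ⟨j, hij.2⟩ else (1 : Matrix ι ι E) i j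
  have hrow : ∀ i j, lam i ≤ k → h i j = (1 : Matrix ι ι E) i j := fun i j hi => by
    simp only [h, Matrix.of_apply]
    rw [dif_neg (by omega)]
  have hcol : ∀ i j, lam j ≤ k → h i j = (1 : Matrix ι ι E) i j := fun i j hi => by
    simp only [h, Matrix.of_apply]
    rw [dif_neg (by omega)]
  have hfix : ∀ a, lam a ≤ k → Sub h (X a) = X a := by
    intro a ha
    rw [Sub_X]
    simp only [hrow a _ ha]
    simp [Matrix.one_apply]
  refine ⟨h, ?_, hcol, hrow, ?_⟩
  · rw [Matrix.twoBlockTriangular_det h (fun i => k < lam i) (by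
      intro i hi j hj
      rw [hrow i j (by omega), Matrix.one_apply, if_neg]
      rintro rfl
      exact hi hj)]
    refine mul_ne_zero ?_ ?_
    · convert hB
      ext i j
      simp only [Matrix.toSquareBlockProp_def, Matrix.of_apply, h]
      rw [dif_pos ⟨i.2, j.2⟩]
    · have : h.toSquareBlockProp (fun i => ¬ (k < lam i)) = 1 := by
        ext i j
        simp only [Matrix.toSquareBlockProp_def, Matrix.of_apply]
        rw [hrow _ _ (by have := i.2; omega), Matrix.one_apply, Matrix.one_apply]
        congr 1
        exact propext Subtype.ext_iff.symm
      rw [this]; simp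
  · intro j
    apply inS_succ P lam (inS_Sub_of_fix P lam (hS j) h (hfix P (by omega)) hfix)
    intro ν hν
    refine coeff_of_cf_eq_zero P lam (k+1) (k+1) _ ?_ ν hν.1 hν.2
    apply MvPolynomial.funext
    intro x
    rw [map_zero, eval_cf]
    let c : Fin (Fintype.card {i // k + 1 < lam i}) → E := fun a => x (g.symm a).1
    have hz : ∀ i, (∑ a, c a • v a) i = ∑ b : {i // k + 1 < lam i}, v (g b) i * x b.1 := by
      intro i
      rw [Finset.sum_apply, ← Equiv.sum_comp g]
      refine Finset.sum_congr rfl fun b _ => ?_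
      simp [c, mul_comm]
    have key : aeval (qv P lam (k+1) x) (Sub h (G j)) = aeval (qv P lam k (∑ a, c a • v a)) (G j) := by
      rw [Sub, ← AlgHom.comp_apply, comp_aeval]
      congr 2
      funext i
      rw [map_sum]
      simp only [map_mul, aeval_X, aeval_C]
      by_cases hi : lam i ≤ k
      · rw [Finset.sum_eq_single i]
        · rw [hrow i i hi]
          simp only [Matrix.one_apply_eq, map_one, one_mul, qv]
          rw [if_neg (show ¬ (k + 1 < lam i) by omega), if_neg (show ¬ (k < lam i) by omega)]
        · intro b _ hb
          rw [hrow i b hi, Matrix.one_apply_ne hb.symm]; simp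
        · simp
      · have hiP : i ≠ P := by rintro rfl; omega
        simp only [qv, if_neg hiP]
        rw [if_pos (show k < lam i by omega), hz, map_sum]
        symm
        apply Fintype.sum_of_injective (fun b : {i // k + 1 < lam i} => b.1) Subtype.val_injective
        · intro b hb
          by_cases hbP : b = P
          · subst hbP
            rw [hcol i b (by omega), Matrix.one_apply_ne hiP]; simp
          · rw [if_neg hbP, if_neg, mul_zero]
            intro h'
            exact hb ⟨⟨b, h'⟩, rfl⟩
        · rintro ⟨b, hb⟩
          have hbP : b ≠ P := by rintro rfl; omega
          simp only
          rw [if_neg hbP, if_pos hb, Polynomial.algebraMap_eq, ← Polynomial.C_mul]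
          congr 2
          simp only [h, Matrix.of_apply]
          rw [dif_pos ⟨by omega, by omega⟩]
          exact (hBw ⟨⟨b, by omega⟩, hb⟩ ⟨i, by omega⟩).symm
    rw [key, ← eval_cf]
    exact hv0 c j

theorem backC {E : Type u} [Field E] [IsAlgClosed E] {m D : ℕ} (hlP : lam P = 0) (dv : Fin m → ℕ) (hD : ∀ j, dv j ≤ D)
    (hcard : ∀ k < D, m * (D + 1) ^ (Fintype.card {i // k + 1 < lam i}) + Fintype.card {i // k + 1 < lam i} <
      Fintype.card {i // k < lam i}) (n : ℕ) :
    ∀ (k : ℕ) (hnk : n + k = D) (G : Fin m → MvPolynomial ι E) (hG : ∀ j, (G j).IsHomogeneous (dv j)) 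
    (hS : ∀ j, InS P lam k (G j)) (hP : ∀ j, eval (Pi.single P 1) (G j) = 0),
    ∃ h : Matrix ι ι E, h.det ≠ 0 ∧ h.mulVec (Pi.single P 1) = Pi.single P 1 ∧
      (∀ i j, lam i = 0 → lam j ≠ 0 → h i j = 0) ∧ ∀ j, InS P lam D (Sub h (G j)) := by
  induction n with
  | zero =>
    intro k hnk G hG hS hP
    obtain rfl : k = D := by omega
    refine ⟨1, by simp, Matrix.one_mulVec _, ?_, fun j => by rw [Sub_one]; exact hS j⟩
    intro i j hi hj
    apply Matrix.one_apply_ne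
    rintro rfl; exact hj hi
  | succ n ih =>
    intro k hnk G hG hS hP
    obtain ⟨h1, hdet, hcol, hrow, hS1⟩ := stepC P lam hlP dv hD (hcard k (by omega)) G hG hS hP
    have hfixP : h1.mulVec (Pi.single P 1) = Pi.single P 1 := by
      rw [Matrix.mulVec_single_one]
      funext i
      rw [Matrix.col_apply, hcol i P (by omega), Matrix.one_apply, Pi.single_apply]
    obtain ⟨h2, hdet2, hfix2, hpat2, hS2⟩ := ih (k+1) (by omega) (fun j => Sub h1 (G j)) (fun j => Sub_homog _ (hG j)) hS1
      (fun j => by rw [eval_Sub, hfixP]; exact hP j)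
    refine ⟨h1 * h2, ?_, ?_, ?_, ?_⟩
    · rw [Matrix.det_mul]; exact mul_ne_zero hdet hdet2
    · rw [← Matrix.mulVec_mulVec, hfix2, hfixP]
    · intro i j hi hj
      rw [Matrix.mul_apply]
      refine Finset.sum_eq_zero fun l _ => ?_
      rw [hrow i l (by omega)]
      by_cases hil : i = l
      · subst hil
        rw [hpat2 i j hi hj, mul_zero]
      · rw [Matrix.one_apply_ne hil, zero_mul]
    · intro j
      rw [← Sub_Sub]
      exact hS2 j

end Back
end MPC

namespace MPC
open MvPolynomial
section Core
variable {ι : Type} [Fintype ι] [DecidableEq ι] (P : ι) (lam : ι → ℕ) {m : ℕ} (dv : Fin m → ℕ)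

/-- The matrix with entries `e`, forced to preserve the span of the variables with `lam = 0`. -/
def gmat {R : Type*} [CommRing R] (e : ι × ι → R) : Matrix ι ι R :=
  Matrix.of fun i j => if lam i = 0 ∧ lam j ≠ 0 then 0 else e (i, j)

theorem gmat_map {R S : Type*} [CommRing R] [CommRing S] (f : R →+* S) (e : ι × ι → R) :
    (gmat lam e).map f = gmat lam (fun p => f (e p)) := by
  ext i j
  simp only [gmat, Matrix.map_apply, Matrix.of_apply]
  split_ifs <;> simp

theorem gmat_pat {R : Type*} [CommRing R] (e : ι × ι → R) (i j : ι) (hi : lam i = 0) (hj : lam j ≠ 0) :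
    gmat lam e i j = 0 := by
  simp [gmat, hi, hj]

theorem gmat_of {R : Type*} [CommRing R] (h : Matrix ι ι R) (hp : ∀ i j, lam i = 0 → lam j ≠ 0 → h i j = 0) :
    gmat lam (fun p => h p.1 p.2) = h := by
  ext i j
  simp only [gmat, Matrix.of_apply]
  split_ifs with hh
  · exact (hp i j hh.1 hh.2).symm
  · rfl

theorem det_gmat {K Ω : Type*} [Field K] [Field Ω] [Algebra K Ω] (e : ι × ι → Ω)
    (he : AlgebraicIndependent K e) : (gmat lam e).det ≠ 0 := by
  intro h0
  let M : Matrix ι ι (MvPolynomial (ι × ι) K) := gmat lam X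
  have h1 : ∀ {S : Type _} [CommRing S] [Algebra K S] (x : ι × ι → S), aeval x M.det = (gmat lam x).det := by
    intro S _ _ x
    have := RingHom.map_det ((aeval x : MvPolynomial (ι × ι) K →ₐ[K] S) : MvPolynomial (ι × ι) K →+* S) M
    rw [RingHom.coe_coe] at this
    rw [this]
    congr 1
    rw [RingHom.mapMatrix_apply, gmat_map]
    simp
  have h2 : M.det = 0 := by
    apply (map_eq_zero_iff _ he).1
    rw [h1, h0]
  have h3 : (gmat lam (fun p => (1 : Matrix ι ι Ω) p.1 p.2)).det = 0 := by
    rw [← h1, h2, map_zero]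
  rw [gmat_of] at h3
  · simp at h3
  · intro i j hi hj
    apply Matrix.one_apply_ne
    rintro rfl; exact hj hi

theorem indep0 {K K1 Ω : Type u} [Field K] [Field K1] [Field Ω] [Algebra K K1] [Algebra K1 Ω] [Algebra K Ω]
    [IsScalarTower K K1 Ω] (hlP : lam P = 0) (G : Fin m → MvPolynomial ι K1)
    (hG : ∀ j, (G j).IsHomogeneous (dv j)) (hS : ∀ j, InS P lam 0 (G j))
    (hind : AlgebraicIndependent K (fun i : Idx P lam dv 0 => coeff i.1.2 (G i.1.1)))
    (e : ι × ι → Ω) (he : AlgebraicIndependent K1 e) :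
    AlgebraicIndependent K (Sum.elim e (fun i : Idx P lam dv 0 =>
      coeff i.1.2 (Sub (gmat lam e) (map (algebraMap K1 Ω) (G i.1.1))))) := by
  have h1 := hind.sumElim_comp he
  refine indep_of_mem le_rfl _ h1 _ ?_
  set F := IntermediateField.adjoin K (Set.range (Sum.elim e (fun i : Idx P lam dv 0 =>
      coeff i.1.2 (Sub (gmat lam e) (map (algebraMap K1 Ω) (G i.1.1)))))) with hF
  have heF : ∀ p, e p ∈ F := fun p => IntermediateField.subset_adjoin _ _ ⟨Sum.inl p, rfl⟩
  have hSm : ∀ j, InS P lam 0 (map (algebraMap K1 Ω) (G j)) := fun j μ hμ =>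
    hS j μ (support_map_subset _ _ hμ)
  have hcF : ∀ j μ, coeff μ (Sub (gmat lam e) (map (algebraMap K1 Ω) (G j))) ∈ F := by
    intro j μ
    refine coeff_mem_of P lam dv F (j := j) (k := 0) (Sub_homog _ ((hG j).map _))
      (inS_zero_Sub P lam (hSm j) hlP _ (gmat_pat lam e)) ?_ μ
    intro μ hμ
    exact IntermediateField.subset_adjoin _ _ ⟨Sum.inr ⟨(j, μ), hμ⟩, rfl⟩
  have hdet := det_gmat lam e he
  let e' : ι × ι → F := fun p => ⟨e p, heF p⟩
  have hmap : (gmat lam e').map (algebraMap F Ω) = gmat lam e := gmat_map lam (algebraMap F Ω) e'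
  have hdet' : IsUnit (gmat lam e').det := by
    rw [isUnit_iff_ne_zero]
    intro h0
    apply hdet
    rw [← hmap, ← RingHom.mapMatrix_apply, ← RingHom.map_det, h0, map_zero]
  have hinv : gmat lam e * ((gmat lam e')⁻¹).map (algebraMap F Ω) = 1 := by
    rw [← hmap, ← Matrix.map_mul, Matrix.mul_nonsing_inv _ hdet']
    exact Matrix.map_one _ (map_zero _) (map_one _)
  rintro (p | i)
  · exact heF p
  · have := coeff_Sub_mem F (((gmat lam e')⁻¹).map (algebraMap F Ω)) (fun i j => ((gmat lam e')⁻¹ i j).2)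
      _ (hcF i.1.1) i.1.2
    rw [Sub_Sub, hinv, Sub_one, coeff_map] at this
    exact this

theorem core2 {K K1 Ω E : Type u} [Field K] [Field K1] [Field Ω] [Field E] [IsAlgClosed E] [Algebra K K1] [Algebra K1 Ω]
    [Algebra K Ω] [Algebra K1 E] [Algebra K E]
    [IsScalarTower K K1 Ω] [IsScalarTower K K1 E] (hlP : lam P = 0) {D : ℕ} (hD : ∀ j, dv j ≤ D)
    (hcard : ∀ k < D, m * (D + 1) ^ (Fintype.card {i // k + 1 < lam i}) + Fintype.card {i // k + 1 < lam i} <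
      Fintype.card {i // k < lam i})
    (hpiv : ∀ k < D, ∃ π : Row P lam dv (k+1) → ι, Function.Injective π ∧ ∀ ρ, π ρ ≠ P ∧ lam (π ρ) = k)
    (G : Fin m → MvPolynomial ι K1)
    (hG : ∀ j, (G j).IsHomogeneous (dv j)) (hS : ∀ j, InS P lam 0 (G j))
    (hind : AlgebraicIndependent K (fun i : Idx P lam dv 0 => coeff i.1.2 (G i.1.1)))
    (hK1 : IntermediateField.adjoin K (⋃ j, Set.range (G j).coeff) = ⊤)
    (e : ι × ι → Ω) (he : AlgebraicIndependent K1 e)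
    (o : ι) (x : ι → E) (hxo : x o = 1) (hxP : x P ≠ 0) (hx : ∀ j, aeval x (G j) = 0) :
    ∃ y : ι → Ω, y o = 1 ∧ (∀ j, aeval y (G j) = 0) ∧
      ∀ f : MvPolynomial ι K1, aeval y f = 0 → aeval x f = 0 := by
  have hSm : ∀ j, InS P lam 0 (map (algebraMap K1 Ω) (G j)) := fun j μ hμ =>
    hS j μ (support_map_subset _ _ hμ)
  have hSE : ∀ j, InS P lam 0 (map (algebraMap K1 E) (G j)) := fun j μ hμ =>
    hS j μ (support_map_subset _ _ hμ)
  obtain ⟨v, hv, hlift⟩ := forward P lam dv hD hpiv (K := K) D 0 rfl (ι × ι) e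
    (fun j => Sub (gmat lam e) (map (algebraMap K1 Ω) (G j)))
    (fun j => Sub_homog _ ((hG j).map _)) (fun j => inS_zero_Sub P lam (hSm j) hlP _ (gmat_pat lam e))
    (indep0 P lam dv hlP G hG hS hind e he)
  let ga : Matrix ι ι E := (1 : Matrix ι ι E).updateCol P x
  have hgadet : ga.det ≠ 0 := by
    have : ga.det = x P := by
      change ((1 : Matrix ι ι E).updateCol P x).det = x P
      rw [← Matrix.cramer_apply, Matrix.cramer_one]; rfl
    rwa [this]
  have hgaP : ga.mulVec (Pi.single P 1) = x := by
    rw [Matrix.mulVec_single_one]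
    funext i
    simp [ga, Matrix.col_apply]
  have hgapat : ∀ i j, lam i = 0 → lam j ≠ 0 → ga i j = 0 := by
    intro i j hi hj
    have h1 : j ≠ P := by rintro rfl; exact hj hlP
    have h2 : i ≠ j := by rintro rfl; exact hj hi
    simp [ga, Matrix.updateCol_apply, h1, Matrix.one_apply_ne h2]
  obtain ⟨h, hdet, hfix, hpat, hSD⟩ := backC P lam hlP dv hD hcard D 0 rfl
    (fun j => Sub ga (map (algebraMap K1 E) (G j))) (fun j => Sub_homog _ ((hG j).map _))
    (fun j => inS_zero_Sub P lam (hSE j) hlP _ hgapat)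
    (fun j => by rw [eval_Sub, hgaP, eval_map, ← aeval_def]; exact hx j)
  have hg0pat : ∀ i j, lam i = 0 → lam j ≠ 0 → (ga * h) i j = 0 := by
    intro i j hi hj
    rw [Matrix.mul_apply]
    refine Finset.sum_eq_zero fun l _ => ?_
    by_cases hl : lam l = 0
    · rw [hpat l j hl hj, mul_zero]
    · rw [hgapat i l hi hl, zero_mul]
  have hg0det : (ga * h).det ≠ 0 := by
    rw [Matrix.det_mul]; exact mul_ne_zero hgadet hdet
  obtain ⟨L, _, _, c, σ, e', G', v', hc, hσ, hce, hcG, hcv, hse, hsG, hsv⟩ :=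
    hlift E (fun p => (ga * h) p.1 p.2) (fun j => Sub (ga * h) (map (algebraMap K1 E) (G j)))
      (fun j => Sub_homog _ ((hG j).map _)) (fun j => by rw [← Sub_Sub]; exact hSD j)
  have hgc : (gmat lam e').map (c : L →+* Ω) = gmat lam e := by
    rw [gmat_map]; congr 1; funext p; exact hce p
  have hgs : (gmat lam e').map (σ : L →+* E) = ga * h := by
    rw [gmat_map, ← gmat_of lam (ga * h) hg0pat]; congr 1; funext p; exact hse p
  have hunit : IsUnit (gmat lam e').det := by
    apply hσ
    have := RingHom.map_det (σ : L →+* E) (gmat lam e')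
    rw [RingHom.mapMatrix_apply, hgs] at this
    change (σ : L →+* E) _ ≠ 0
    rw [this]; exact hg0det
  have hmulinv := Matrix.mul_nonsing_inv _ hunit
  let p : ι → L := (gmat lam e').mulVec v'
  have hcp : ∀ i, c (p i) = (gmat lam e).mulVec v i := by
    intro i
    rw [← hgc]
    simp only [p, Matrix.mulVec, dotProduct, map_sum, map_mul, hcv, Matrix.map_apply, RingHom.coe_coe]
  have hsp : ∀ i, σ (p i) = x i := by
    intro i
    have h1 : (ga * h).mulVec (Pi.single P 1) = x := by
      rw [← Matrix.mulVec_mulVec, hfix, hgaP]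
    rw [← h1, ← hgs]
    simp only [p, Matrix.mulVec, dotProduct, map_sum, map_mul, hsv, Matrix.map_apply, RingHom.coe_coe]
  obtain ⟨t, ht⟩ : ∃ t, t * p o = 1 := by
    have := hσ (p o) (by rw [hsp, hxo]; exact one_ne_zero)
    exact this.exists_left_inv
  have hst : σ t = 1 := by
    have := congrArg σ ht
    rwa [map_mul, hsp, hxo, mul_one, map_one] at this
  refine ⟨fun i => c (t * p i), by simp only [ht, map_one], ?_, ?_⟩
  · intro j
    simp only [map_mul]
    rw [homog_aeval_smul (hG j)]
    have h1 := hv j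
    rw [eval_Sub, eval_map, ← aeval_def] at h1
    have : (fun i => c (p i)) = (gmat lam e).mulVec v := funext hcp
    rw [this, h1, mul_zero]
  · have hK1L : ∀ a : K1, ∃ l, c l = algebraMap K1 Ω a ∧ σ l = algebraMap K1 E a := by
      intro a
      have ha : a ∈ IntermediateField.adjoin K (⋃ j, Set.range (G j).coeff) := by rw [hK1]; trivial
      induction ha using IntermediateField.adjoin_induction with
      | mem a ha =>
        obtain ⟨j, hj⟩ := Set.mem_iUnion.1 ha
        obtain ⟨μ, rfl⟩ := hj
        refine ⟨coeff μ (Sub (gmat lam e')⁻¹ (G' j)), ?_, ?_⟩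
        · have h1 : map (c : L →+* Ω) (Sub (gmat lam e')⁻¹ (G' j)) = map (algebraMap K1 Ω) (G j) := by
            rw [map_Sub, hcG, Sub_Sub, ← hgc, ← Matrix.map_mul, hmulinv]
            simp [Sub_one]
          have h2 := congrArg (coeff μ) h1
          rw [coeff_map, coeff_map] at h2
          exact h2
        · have h1 : map (σ : L →+* E) (Sub (gmat lam e')⁻¹ (G' j)) = map (algebraMap K1 E) (G j) := by
            rw [map_Sub, hsG, Sub_Sub, ← hgs, ← Matrix.map_mul, hmulinv]
            simp [Sub_one]
          have h2 := congrArg (coeff μ) h1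
          rw [coeff_map, coeff_map] at h2
          exact h2
      | algebraMap a =>
        refine ⟨algebraMap K L a, ?_, ?_⟩
        · rw [c.commutes, ← IsScalarTower.algebraMap_apply]
        · rw [σ.commutes, ← IsScalarTower.algebraMap_apply]
      | add a b _ _ ha hb =>
        obtain ⟨l, h1, h2⟩ := ha
        obtain ⟨l', h1', h2'⟩ := hb
        exact ⟨l + l', by rw [map_add, map_add, h1, h1'], by rw [map_add, map_add, h2, h2']⟩
      | mul a b _ _ ha hb =>
        obtain ⟨l, h1, h2⟩ := ha
        obtain ⟨l', h1', h2'⟩ := hb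
        exact ⟨l * l', by rw [map_mul, map_mul, h1, h1'], by rw [map_mul, map_mul, h2, h2']⟩
      | inv a _ ha =>
        obtain ⟨l, h1, h2⟩ := ha
        by_cases h0 : a = 0
        · exact ⟨0, by simp [h0], by simp [h0]⟩
        · obtain ⟨l', hl'⟩ := (hσ l (by rw [h2]; simpa using h0)).exists_left_inv
          refine ⟨l', ?_, ?_⟩
          · rw [map_inv₀, ← h1]
            exact eq_inv_of_mul_eq_one_left (by rw [← map_mul, hl', map_one])
          · rw [map_inv₀, ← h2]
            exact eq_inv_of_mul_eq_one_left (by rw [← map_mul, hl', map_one])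
    have hf : ∀ f : MvPolynomial ι K1, ∃ l, c l = aeval (fun i => c (t * p i)) f ∧ σ l = aeval x f := by
      intro f
      induction f using MvPolynomial.induction_on with
      | C a => obtain ⟨l, h1, h2⟩ := hK1L a; exact ⟨l, by rw [h1, aeval_C], by rw [h2, aeval_C]⟩
      | add f g hf hg =>
        obtain ⟨l, h1, h2⟩ := hf
        obtain ⟨l', h1', h2'⟩ := hg
        exact ⟨l + l', by rw [map_add, map_add, h1, h1'], by rw [map_add, map_add, h2, h2']⟩
      | mul_X f i hf =>
        obtain ⟨l, h1, h2⟩ := hf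
        exact ⟨l * (t * p i), by rw [map_mul c l, map_mul (aeval _) f, h1, aeval_X],
          by rw [map_mul σ l, map_mul (aeval _) f, h2, aeval_X, map_mul, hst, one_mul, hsp]⟩
    intro f hf0
    obtain ⟨l, h1, h2⟩ := hf f
    rw [hf0] at h1
    rw [← h2, (map_eq_zero_iff c hc).1 h1, map_zero]

end Core
end MPC

namespace MPC
open MvPolynomial

def sz (m D : ℕ) : ℕ → ℕ
  | 0 => 0
  | i + 1 => m * (D + 1) ^ sz m D i + sz m D i + 1

theorem sz_mono (m D : ℕ) : Monotone (sz m D) := monotone_nat_of_le_succ fun i => by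
  simp only [sz]; omega

/-- least `k` with `n k ≤ i` -/
noncomputable def lamOf (m D i : ℕ) : ℕ := sInf {k | sz m D (D - k) ≤ i}

theorem lt_lamOf (m D i k : ℕ) : k < lamOf m D i ↔ i < sz m D (D - k) := by
  have hne : {k | sz m D (D - k) ≤ i}.Nonempty := ⟨D, by simp [sz]⟩
  constructor
  · intro h
    by_contra h'
    exact absurd (Nat.sInf_le (s := {k | sz m D (D - k) ≤ i}) (m := k) (by simpa using h')) (by
      unfold lamOf at h; omega)
  · intro h
    by_contra h'
    have h1 := Nat.sInf_mem hne
    change sz m D (D - lamOf m D i) ≤ i at h1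
    have := sz_mono m D (show D - k ≤ D - lamOf m D i by omega)
    omega

theorem card_lam (m D k r : ℕ) (h : sz m D D ≤ r + 1) :
    Fintype.card {i : Fin (r+1) // k < lamOf m D i} = sz m D (D - k) := by
  have := sz_mono m D (show D - k ≤ D by omega)
  simp only [lt_lamOf]
  exact Fintype.card_fin_lt_of_le (by omega)

theorem card_Row {ι : Type} [Fintype ι] [DecidableEq ι] (P : ι) (lam : ι → ℕ) {m : ℕ} (dv : Fin m → ℕ)
    {D : ℕ} (hD : ∀ j, dv j ≤ D) (k : ℕ) :
    Nat.card (Row P lam dv k) ≤ m * (D + 1) ^ Fintype.card {i // k < lam i} := by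
  let f : Row P lam dv k → Fin m × ({i // k < lam i} → Fin (D + 1)) := fun ρ =>
    (ρ.1.1, fun i => ⟨ρ.1.2 i, by
      have h1 := ρ.2.1
      have h2 := hD ρ.1.1
      have h3 := Finsupp.le_degree i.1 ρ.1.2
      omega⟩)
  have hf : Function.Injective f := by
    rintro ⟨⟨j, μ⟩, h1, h2, h3⟩ ⟨⟨j', μ'⟩, h1', h2', h3'⟩ h
    have ha : j = j' := congrArg Prod.fst h
    have hb := congrArg Prod.snd h
    simp only [f] at hb
    subst ha
    have : μ = μ' := by
      ext a
      by_cases haP : a = P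
      · subst haP; exact h2.trans h2'.symm
      by_cases hk : k < lam a
      · have := congrArg Fin.val (congrFun hb ⟨a, hk⟩)
        exact this
      · have e1 : μ a = 0 := by by_contra h0; exact hk (h3 a haP h0)
        have e2 : μ' a = 0 := by by_contra h0; exact hk (h3' a haP h0)
        rw [e1, e2]
    subst this
    rfl
  have := Nat.card_le_card_of_injective f hf
  rw [Nat.card_eq_fintype_card (α := Fin m × _)] at this
  simpa using this

theorem pivots {m : ℕ} (dv : Fin m → ℕ) {D : ℕ} (hD : ∀ j, dv j ≤ D) (r : ℕ) (hr : 2 * sz m D D ≤ r)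
    (P : Fin (r+1)) (hlP : lamOf m D P = 0) (k : ℕ) (hk : k < D) :
    ∃ π : Row P (fun i : Fin (r+1) => lamOf m D i) dv (k+1) → Fin (r+1), Function.Injective π ∧
      ∀ ρ, π ρ ≠ P ∧ lamOf m D (π ρ) = k := by
  classical
  have hR := card_Row P (fun i : Fin (r+1) => lamOf m D i) dv hD (k+1)
  rw [card_lam m D (k+1) r (by omega)] at hR
  have hsz : ∀ l < D, m * (D+1) ^ (sz m D (D - (l+1))) + sz m D (D - (l+1)) < sz m D (D - l) := by
    intro l hl
    obtain ⟨i, hi⟩ : ∃ i, D - l = i + 1 := ⟨D - l - 1, by omega⟩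
    rw [hi, show D - (l+1) = i by omega]
    simp only [sz]; omega
  have hT : m * (D+1) ^ (sz m D (D - (k+1))) ≤ Fintype.card {i : Fin (r+1) // i ≠ P ∧ lamOf m D i = k} := by
    rcases Nat.eq_zero_or_pos k with rfl | hk0
    · have h1 : Fintype.card (Fin (r+1)) ≤ Fintype.card ({i : Fin (r+1) // 0 < lamOf m D i} ⊕
          Unit ⊕ {i : Fin (r+1) // i ≠ P ∧ lamOf m D i = 0}) := by
        apply Fintype.card_le_of_surjective (Sum.elim Subtype.val (Sum.elim (fun _ => P) Subtype.val))
        intro i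
        by_cases h0 : 0 < lamOf m D i
        · exact ⟨Sum.inl ⟨i, h0⟩, rfl⟩
        by_cases hP : i = P
        · exact ⟨Sum.inr (Sum.inl ()), hP.symm⟩
        · exact ⟨Sum.inr (Sum.inr ⟨i, hP, by omega⟩), rfl⟩
      rw [Fintype.card_sum, Fintype.card_sum, card_lam m D 0 r (by omega)] at h1
      have := hsz 0 hk
      simp only [Fintype.card_fin, Fintype.card_unit, Nat.sub_zero] at h1 this
      omega
    · have h1 : Fintype.card {i : Fin (r+1) // k - 1 < lamOf m D i} ≤ Fintype.card ({i : Fin (r+1) // k < lamOf m D i} ⊕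
          {i : Fin (r+1) // i ≠ P ∧ lamOf m D i = k}) := by
        apply Fintype.card_le_of_injective (fun i => if h : k < lamOf m D i.1 then Sum.inl ⟨i.1, h⟩ else
          Sum.inr ⟨i.1, by rintro h'; have := i.2; rw [h'] at this; omega, by have := i.2; omega⟩)
        intro i j hij
        simp only at hij
        split_ifs at hij
        · have h5 := congrArg Subtype.val (Sum.inl_injective hij)
          exact Subtype.ext h5
        · have h5 := congrArg Subtype.val (Sum.inr_injective hij)
          exact Subtype.ext h5
      rw [Fintype.card_sum, card_lam m D _ r (by omega), card_lam m D _ r (by omega)] at h1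
      have := hsz (k-1) (by omega)
      rw [show k - 1 + 1 = k by omega] at this
      have h2 : m * (D+1) ^ (sz m D (D - (k+1))) ≤ m * (D+1) ^ (sz m D (D - k)) :=
        Nat.mul_le_mul_left _ (Nat.pow_le_pow_right (by omega) (sz_mono m D (by omega)))
      omega
  letI : Fintype (Row P (fun i : Fin (r+1) => lamOf m D i) dv (k+1)) := Fintype.ofFinite _
  rw [Nat.card_eq_fintype_card] at hR
  obtain ⟨f⟩ := Function.Embedding.nonempty_of_card_le (hR.trans hT)
  exact ⟨fun ρ => (f ρ).1, fun a b h => f.injective (Subtype.ext h), fun ρ => (f ρ).2⟩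

/-- dehomogenization map -/
noncomputable def dh (r : ℕ) (K1 : Type u) [Field K1] : MvPolynomial (Fin (r+1)) K1 →ₐ[K1] MvPolynomial (Fin r) K1 :=
  aeval (fun i : Fin (r + 1) =>
            Fin.cases (motive := fun _ => MvPolynomial (Fin r) K1) 1 (fun i' => MvPolynomial.X i') i)

theorem aeval_dh {r : ℕ} {K1 S : Type*} [Field K1] [CommRing S] [Algebra K1 S] (y : Fin (r+1) → S) (h0 : y 0 = 1)
    (f : MvPolynomial (Fin (r+1)) K1) : aeval (fun i => y (Fin.succ i)) (dh r K1 f) = aeval y f := by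
  have : (aeval (fun i => y (Fin.succ i))).comp (dh r K1) = aeval y := by
    apply MvPolynomial.algHom_ext
    intro i
    rw [AlgHom.comp_apply, dh, aeval_X, aeval_X]
    refine Fin.cases ?_ (fun i => ?_) i
    · simp [h0]
    · simp
  rw [← this]; rfl

theorem exists_P {r q m : ℕ} {K1 : Type u} [Field K1] (hr : q + m < r) (G : Fin m → MvPolynomial (Fin (r+1)) K1)
    (hY : ∀ j, ∀ μ ∈ (G j).support, ∃ i : Fin (r + 1), q < (i : ℕ) ∧ μ i ≠ 0) :
    ∃ i : Fin r, q < (i.succ : ℕ) ∧ (X i : MvPolynomial (Fin r) K1) ∉ Ideal.span (Set.range fun j => dh r K1 (G j)) := by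
  by_contra hcon
  push Not at hcon
  let E := AlgebraicClosure K1
  obtain ⟨w, hw, hw0⟩ := proj_dim (E := E) (ι := Fin r) (κ := Fin m ⊕ Fin q)
    (Sum.elim (fun j => map (algebraMap K1 E) (dh r K1 (G j))) (fun i => X ⟨i, by omega⟩)) (by simp; omega) (by
      rintro (j | i)
      · simp only [Sum.elim_inl]
        rw [eval_map, ← aeval_def]
        let y : Fin (r+1) → E := fun i => if i = 0 then 1 else 0
        have h1 : (0 : Fin r → E) = fun i => y i.succ := by funext i; simp [y]
        rw [h1, aeval_dh y (by simp [y]), aeval_def, eval₂_eq']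
        refine Finset.sum_eq_zero fun μ hμ => ?_
        obtain ⟨i, hi, hμi⟩ := hY j μ hμ
        have hi0 : i ≠ 0 := by rintro rfl; simp at hi
        rw [Finset.prod_eq_zero (Finset.mem_univ i), mul_zero]
        simp [y, hi0, hμi]
      · simp)
  apply hw
  have hker : ∀ f ∈ Ideal.span (Set.range fun j => dh r K1 (G j)), aeval w f = 0 := by
    intro f hf
    have : Ideal.span (Set.range fun j => dh r K1 (G j)) ≤ RingHom.ker (aeval w : MvPolynomial (Fin r) K1 →ₐ[K1] E) := by
      rw [Ideal.span_le]
      rintro _ ⟨j, rfl⟩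
      have := hw0 (Sum.inl j)
      simp only [Sum.elim_inl] at this
      rw [eval_map, ← aeval_def] at this
      exact this
    exact this hf
  funext i
  by_cases hi : q < (i.succ : ℕ)
  · simpa using hker _ (hcon i hi)
  · have : (i : ℕ) < q := by simp at hi; omega
    simpa using hw0 (Sum.inr ⟨i, this⟩)

theorem final (K : Type u) [Field K] (m : ℕ) (dv : Fin m → ℕ) (D : ℕ) (hD : ∀ j, dv j ≤ D) (hm : 0 < m) (hD0 : 0 < D)
    (r : ℕ) (hr : 2 * sz m D D ≤ r) (K1 : Type u) [Field K1] [Algebra K K1]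
    (G : Fin m → MvPolynomial (Fin (r + 1)) K1) (q : ℕ) (hq : q + 1 = sz m D D)
    (hG : ∀ j, (G j).IsHomogeneous (dv j))
    (hY : ∀ j, ∀ μ ∈ (G j).support, ∃ i : Fin (r + 1), q < (i : ℕ) ∧ μ i ≠ 0)
    (hind : AlgebraicIndependent K (fun p : (Σ j : Fin m, {μ : Fin (r + 1) →₀ ℕ //
          (∑ i, μ i) = dv j ∧ ∃ i : Fin (r + 1), q < (i : ℕ) ∧ μ i ≠ 0}) =>
        (G p.1).coeff p.2.1))
    (hK1 : IntermediateField.adjoin K (⋃ j, Set.range (G j).coeff) = ⊤)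
    (I : Ideal (MvPolynomial (Fin r) K1)) (hI : I = Ideal.span (Set.range fun j => dh r K1 (G j)))
    (hprime : I.IsPrime) :
    ∃ (N : ℕ) (ψ : FractionRing ((MvPolynomial (Fin r) K1) ⧸ I) →ₐ[K1]
            FractionRing (MvPolynomial (Fin N) K1)), Function.Injective ψ := by
  have hmsz : m < sz m D D := by
    obtain ⟨D', rfl⟩ : ∃ D', D = D' + 1 := ⟨D - 1, by omega⟩
    simp only [sz]
    have := Nat.le_mul_of_pos_right m (show 0 < (D' + 1 + 1) ^ sz m (D'+1) D' by positivity)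
    omega
  obtain ⟨i0, hi0, hi0I⟩ := exists_P (q := q) (by omega) G hY
  rw [← hI] at hi0I
  let P : Fin (r+1) := i0.succ
  let lam : Fin (r+1) → ℕ := fun i => lamOf m D i
  have hlam : ∀ i, lam i = 0 ↔ q < (i : ℕ) := by
    intro i
    have := lt_lamOf m D i 0
    simp only [Nat.sub_zero] at this
    simp only [lam]
    omega
  have hlP : lam P = 0 := (hlam P).2 hi0
  have hgood : ∀ μ, Good P lam 0 μ ↔ ∃ i : Fin (r + 1), q < (i : ℕ) ∧ μ i ≠ 0 := by
    intro μ
    constructor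
    · intro h
      by_cases hP : μ P = 0
      · obtain ⟨a, _, h1, h2⟩ := h (by omega)
        exact ⟨a, (hlam a).1 (by omega), h1⟩
      · exact ⟨P, hi0, hP⟩
    · rintro ⟨i, hi, hμ⟩ hP
      refine ⟨i, ?_, hμ, ?_⟩
      · rintro rfl; omega
      · rw [(hlam i).2 hi]; omega
  have hS : ∀ j, InS P lam 0 (G j) := fun j μ hμ => (hgood μ).2 (hY j μ hμ)
  have hind' : AlgebraicIndependent K (fun i : Idx P lam dv 0 => coeff i.1.2 (G i.1.1)) := by
    refine hind.comp (fun i : Idx P lam dv 0 => ⟨i.1.1, i.1.2, by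
      rw [← Finsupp.degree_eq_sum]; exact i.2.1, (hgood _).1 i.2.2⟩) ?_
    rintro ⟨⟨j, μ⟩, h1⟩ ⟨⟨j', μ'⟩, h1'⟩ h
    simp only [Sigma.mk.injEq] at h
    obtain ⟨rfl, h⟩ := h
    have := congrArg Subtype.val (eq_of_heq h)
    simp only at this
    subst this
    rfl
  have hcard : ∀ k < D, m * (D + 1) ^ (Fintype.card {i // k + 1 < lam i}) + Fintype.card {i // k + 1 < lam i} <
      Fintype.card {i // k < lam i} := by
    intro k hk
    rw [card_lam m D _ r (by omega), card_lam m D _ r (by omega)]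
    obtain ⟨i, hi⟩ : ∃ i, D - k = i + 1 := ⟨D - k - 1, by omega⟩
    rw [hi, show D - (k+1) = i by omega]
    simp only [sz]; omega
  let A := MvPolynomial (Fin r) K1 ⧸ I
  haveI : IsDomain A := Ideal.Quotient.isDomain I
  let E := AlgebraicClosure (FractionRing A)
  haveI : IsScalarTower K K1 E := inferInstance
  let N := Fintype.card (Fin (r+1) × Fin (r+1))
  let Ω := FractionRing (MvPolynomial (Fin N) K1)
  haveI : IsScalarTower K K1 Ω := inferInstance
  let φ : MvPolynomial (Fin r) K1 →ₐ[K1] E :=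
    (IsScalarTower.toAlgHom K1 (FractionRing A) E).comp
      ((IsScalarTower.toAlgHom K1 A (FractionRing A)).comp (Ideal.Quotient.mkₐ K1 I))
  have hφ : ∀ f, φ f = 0 ↔ f ∈ I := by
    intro f
    change algebraMap (FractionRing A) E (algebraMap A (FractionRing A) (Ideal.Quotient.mk I f)) = 0 ↔ _
    rw [map_eq_zero_iff _ (algebraMap (FractionRing A) E).injective,
      map_eq_zero_iff _ (IsFractionRing.injective A (FractionRing A)), Ideal.Quotient.eq_zero_iff_mem]
  let x : Fin (r+1) → E := fun i => Fin.cases (motive := fun _ => E) 1 (fun i' => φ (X i')) i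
  have hx0 : x 0 = 1 := rfl
  have hxs : (fun i : Fin r => x i.succ) = fun i => φ (X i) := rfl
  have hxφ : ∀ f : MvPolynomial (Fin r) K1, aeval (fun i : Fin r => x i.succ) f = φ f := by
    intro f
    rw [hxs]
    exact (congrFun (congrArg DFunLike.coe (aeval_unique φ)) f).symm
  have hX : AlgebraicIndependent K1 (fun p : Fin (r+1) × Fin (r+1) =>
      algebraMap (MvPolynomial (Fin N) K1) Ω (X (Fintype.equivFin _ p))) := by
    have h1 : AlgebraicIndependent K1 (X : Fin N → MvPolynomial (Fin N) K1) := algebraicIndependent_X _ _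
    have h2 := h1.map' (f := IsScalarTower.toAlgHom K1 (MvPolynomial (Fin N) K1) Ω)
      (IsFractionRing.injective (MvPolynomial (Fin N) K1) Ω)
    exact h2.comp _ (Fintype.equivFin _).injective
  obtain ⟨y, hy0, hyG, hyf⟩ := core2 (K := K) (K1 := K1) (Ω := Ω) (E := E) P lam dv hlP hD hcard
    (fun k hk => pivots dv hD r hr P hlP k hk) G hG hS hind' hK1 _ hX 0 x hx0
    (by
      change φ (X i0) ≠ 0
      rw [Ne, hφ]; exact hi0I)
    (by
      intro j
      rw [← aeval_dh x hx0, hxφ, hφ, hI]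
      exact Ideal.subset_span ⟨j, rfl⟩)
  let ψ0 : MvPolynomial (Fin r) K1 →ₐ[K1] Ω := aeval (fun i : Fin r => y i.succ)
  have hψ0 : ∀ f ∈ I, ψ0 f = 0 := by
    intro f hf
    have : I ≤ RingHom.ker ψ0 := by
      rw [hI, Ideal.span_le]
      rintro _ ⟨j, rfl⟩
      change ψ0 _ = 0
      rw [aeval_dh y hy0]; exact hyG j
    exact this hf
  let ψ1 : A →ₐ[K1] Ω := Ideal.Quotient.liftₐ I ψ0 hψ0
  have hψ1 : Function.Injective ψ1 := by
    rw [injective_iff_map_eq_zero]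
    intro a ha
    obtain ⟨f, rfl⟩ := Ideal.Quotient.mk_surjective a
    have h1 : ψ0 f = 0 := ha
    rw [Ideal.Quotient.eq_zero_iff_mem, ← hφ, ← hxφ]
    have h2 := hyf (rename Fin.succ f)
    rw [aeval_rename, aeval_rename] at h2
    exact h2 h1
  refine ⟨N, IsFractionRing.liftAlgHom (K := FractionRing A) hψ1, ?_⟩
  exact RingHom.injective _

end MPC

/-- **Theorem of Morin and Predonzan, in the version of Ciliberto.** Let `K` be a field
of characteristic zero and `d̲ = (d_1, …, d_m)` a multidegree with
`0 < d_1 ≤ d_2 ≤ … ≤ d_m`. Then there exist positive integers `c(d̲)` and `q(d̲)` such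
that for every `r ≥ c(d̲)`, every complete intersection `V` of multidegree `d̲` in `ℙ^r`
which is generic over `K` subject to containing a linear space `L₀ ≅ ℙ^{q(d̲)}` is
unirational over the field `K(l(L₀), θ(V))` (see `MPCProperty` for the precise function
field formulation). -/
theorem stmt_1 (K : Type u) [Field K] [CharZero K] (m : ℕ) (hm : 0 < m)
    (dv : Fin m → ℕ) (hdv : ∀ j, 0 < dv j) (hmono : Monotone dv) :
    ∃ c q : ℕ, 0 < c ∧ 0 < q ∧ q < c ∧ MPCProperty K m dv c q := by
  classical
  let D := ∑ j, dv j
  have hD : ∀ j, dv j ≤ D := fun j => Finset.single_le_sum (f := dv) (fun _ _ => Nat.zero_le _) (Finset.mem_univ j)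
  have hD0 : 0 < D := lt_of_lt_of_le (hdv ⟨0, hm⟩) (hD ⟨0, hm⟩)
  have hmsz : m < MPC.sz m D D := by
    have h1 := MPC.sz_mono m D (show 1 ≤ D from hD0)
    have h2 : MPC.sz m D 1 = m + 1 := by simp [MPC.sz]
    omega
  refine ⟨2 * MPC.sz m D D, MPC.sz m D D - 1, by omega, by omega, by omega, ?_⟩
  intro r hr _ K1 _ _ G hG hY hind hK1 hprime
  exact MPC.final K m dv D hD hm hD0 r hr K1 G (MPC.sz m D D - 1) (by omega) hG hY hind hK1 _ rfl hprime
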